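/- (Variance of increments away from the boundary.) Let ψ be the (σ,λ)-GFF on V_N, let λ_{i−1} ≤ α < α' ≤ λ_i for some i ∈ {1,...,M} with α ≠ 0, and let ρ ∈ (0,α]. Then there is a constant C > 0 such that for all N large enough (dependent on α but independent of ρ), max_{v∈A_{N,ρ}} |E[ψ_v(α,α')²] − (α' − α) σ_i² log N| ≤ C σ_i². -/

import Mathlib

open Filter
open scoped Classical

noncomputable section GFFCommon

/-- Vertices of `ℤ²`. -/
abbrev Vtx : Type := ℤ × ℤ

/-- Sample space: a real-valued field indexed by the vertices of `ℤ²`. -/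
abbrev FieldSp : Type := Vtx → ℝ

/-- The box `V_N = {0,1,…,N}²`. -/
def VN (N : ℕ) : Finset Vtx := Finset.Icc (0, 0) ((N : ℤ), (N : ℤ))

/-- The boundary `∂B` of a finite box `B ⊆ ℤ²`:
vertices of `B` having a (Euclidean distance 1) neighbour outside `B`. -/
def bdry (B : Finset Vtx) : Finset Vtx :=
  B.filter fun v =>
    ¬((v.1 + 1, v.2) ∈ B ∧ (v.1 - 1, v.2) ∈ B ∧ (v.1, v.2 + 1) ∈ B ∧ (v.1, v.2 - 1) ∈ B)

/-- The interior `B° = B ∖ ∂B`. -/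
def intr (B : Finset Vtx) : Finset Vtx := B \ bdry B

/-- The neighbourhood `[v]_λ` of `v` in `V_N`. -/
def nbhd (N : ℕ) (lam : ℝ) (v : Vtx) : Finset Vtx :=
  if lam = 0 then VN N
  else if lam = 1 then {v}
  else (VN N).filter fun w =>
    |(w.1 : ℝ) - (v.1 : ℝ)| ≤ (N : ℝ) ^ ((1 : ℝ) - lam) / 2 ∧
    |(w.2 : ℝ) - (v.2 : ℝ)| ≤ (N : ℝ) ^ ((1 : ℝ) - lam) / 2

/-- The σ-algebra `F_{∂[v]_λ ∪ [v]_λ^c}`, generated by the field variables on the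
boundary of `[v]_λ` and those outside of it. -/
def scaleAlg (N : ℕ) (lam : ℝ) (v : Vtx) : MeasurableSpace FieldSp :=
  ⨆ w ∈ {w : Vtx | w ∈ VN N ∧ w ∉ intr (nbhd N lam v)},
    MeasurableSpace.comap (fun ω : FieldSp => ω w) inferInstance

/-- `G` is the Green function of simple random walk killed on `∂B`, normalized by `π/2`:
it vanishes unless both arguments are in `B°`, and in `B°` it satisfies the
first-step (discrete Poisson equation) characterization
`G(x,y) = (1/4)·Σ_{x'∼x} G(x',y) + (π/2)·1_{x=y}`. -/
def IsGreenFn (B : Finset Vtx) (G : Vtx → Vtx → ℝ) : Prop :=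
  (∀ x y : Vtx, x ∉ intr B ∨ y ∉ intr B → G x y = 0) ∧
  ∀ y ∈ intr B, ∀ x ∈ intr B,
    G x y = (G (x.1 + 1, x.2) y + G (x.1 - 1, x.2) y
        + G (x.1, x.2 + 1) y + G (x.1, x.2 - 1) y) / 4
      + (Real.pi / 2) * (if x = y then 1 else 0)

/-- `P` is the law (on the canonical space `FieldSp`) of the Gaussian free field on `V_N`:
a centered Gaussian field with covariance the Green function `G_{V_N}`. -/
def IsGFF (N : ℕ) (P : MeasureTheory.Measure FieldSp) : Prop :=
  MeasureTheory.IsProbabilityMeasure P ∧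
  ∃ G : Vtx → Vtx → ℝ, IsGreenFn (VN N) G ∧
    ∀ c : Vtx → ℝ,
      P.map (fun ω => ∑ v ∈ VN N, c v * ω v) =
        ProbabilityTheory.gaussianReal 0 (Real.toNNReal (∑ v ∈ VN N, ∑ w ∈ VN N, c v * c w * G v w))

open MeasureTheory in
/-- `φ_v(λ) = E[φ_v | F_{∂[v]_λ ∪ [v]_λ^c}]`. -/
def phiScale (N : ℕ) (P : MeasureTheory.Measure FieldSp) (v : Vtx) (lam : ℝ) : FieldSp → ℝ :=
  P[fun ω : FieldSp => ω v | scaleAlg N lam v]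

/-- Admissible parameters `(σ,λ)`: `σ_1,…,σ_M > 0` and `0 = λ_0 < λ_1 < … < λ_M = 1`. -/
def ScaleParams (M : ℕ) (sigv lamv : ℕ → ℝ) : Prop :=
  1 ≤ M ∧ (∀ i ∈ Finset.Icc 1 M, 0 < sigv i) ∧
  lamv 0 = 0 ∧ lamv M = 1 ∧ ∀ i, i < M → lamv i < lamv (i + 1)

/-- The `(σ,λ)`-GFF: `ψ_v = Σ_{i=1}^M σ_i (φ_v(λ_i) − φ_v(λ_{i−1}))`. -/
def psiFld (N M : ℕ) (sigv lamv : ℕ → ℝ) (P : MeasureTheory.Measure FieldSp) (v : Vtx) : FieldSp → ℝ :=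
  fun ω => ∑ i ∈ Finset.Icc 1 M, sigv i * (phiScale N P v (lamv i) ω - phiScale N P v (lamv (i - 1)) ω)

open MeasureTheory in
/-- `ψ_v(λ) = E[ψ_v | F_{∂[v]_λ ∪ [v]_λ^c}]`. -/
def psiScale (N M : ℕ) (sigv lamv : ℕ → ℝ) (P : MeasureTheory.Measure FieldSp) (v : Vtx) (lam : ℝ) :
    FieldSp → ℝ :=
  P[psiFld N M sigv lamv P v | scaleAlg N lam v]

/-- The increment `ψ_v(λ,λ') = ψ_v(λ') − ψ_v(λ)`. -/
def psiInc (N M : ℕ) (sigv lamv : ℕ → ℝ) (P : MeasureTheory.Measure FieldSp) (v : Vtx) (lam lam' : ℝ) :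
    FieldSp → ℝ :=
  fun ω => psiScale N M sigv lamv P v lam' ω - psiScale N M sigv lamv P v lam ω

/-- The step function `σ(s) = σ_1 1_{{0}}(s) + Σ_{i=1}^M σ_i 1_{(λ_{i−1},λ_i]}(s)`. -/
def stepFn (M : ℕ) (sigv lamv : ℕ → ℝ) (s : ℝ) : ℝ :=
  (if s = 0 then sigv 1 else 0) +
  ∑ i ∈ Finset.Icc 1 M, if lamv (i - 1) < s ∧ s ≤ lamv i then sigv i else 0

/-- `𝒥_f(s) = ∫_0^s f(r) dr`. -/
def Jint (f : ℝ → ℝ) (s : ℝ) : ℝ := ∫ r in (0:ℝ)..s, f r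

/-- `𝒥_f(s₁,s₂) = ∫_{s₁}^{s₂} f(r) dr`. -/
def Jint2 (f : ℝ → ℝ) (s₁ s₂ : ℝ) : ℝ := ∫ r in s₁..s₂, f r

/-- The speed function `𝒥_{σ²}`. -/
def Jsig2 (M : ℕ) (sigv lamv : ℕ → ℝ) (s : ℝ) : ℝ := Jint (fun r => (stepFn M sigv lamv r) ^ 2) s

/-- The normalized speed function `𝒥̄_{σ²} = 𝒥_{σ²}/𝒥_{σ²}(1)`. -/
def JsigBar (M : ℕ) (sigv lamv : ℕ → ℝ) (s : ℝ) : ℝ := Jsig2 M sigv lamv s / Jsig2 M sigv lamv 1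

/-- The concave hull on `[0,1]` of a function `f`, i.e. the pointwise infimum over all
concave functions dominating `f` on `[0,1]`. -/
def concaveHull (f : ℝ → ℝ) (s : ℝ) : ℝ :=
  sInf {y | ∃ g : ℝ → ℝ, ConcaveOn ℝ (Set.Icc (0:ℝ) 1) g ∧
    (∀ t ∈ Set.Icc (0:ℝ) 1, f t ≤ g t) ∧ y = g s}

/-- The effective parameters: jump scales `0 = λ⁰ < … < λ^m = 1`, values
`σ̄_1 > … > σ̄_m > 0`, and the left-continuous non-increasing step function `σ̄`
such that `∫_0^s σ̄²` is the concavification of `𝒥_{σ²}`. -/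
def EffParams (M : ℕ) (sigv lamv : ℕ → ℝ) (m : ℕ) (sigb lamb : ℕ → ℝ) (sigbar : ℝ → ℝ) : Prop :=
  1 ≤ m ∧ m ≤ M ∧ lamb 0 = 0 ∧ lamb m = 1 ∧ (∀ j, j < m → lamb j < lamb (j + 1)) ∧
  (∀ l, 1 ≤ l → l < m → sigb (l + 1) < sigb l) ∧ (∀ l ∈ Finset.Icc 1 m, 0 < sigb l) ∧
  sigbar 0 = sigb 1 ∧
  (∀ l ∈ Finset.Icc 1 m, ∀ s : ℝ, lamb (l - 1) < s → s ≤ lamb l → sigbar s = sigb l) ∧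
  (∀ s : ℝ, 0 < s → s ≤ 1 →
    concaveHull (Jsig2 M sigv lamv) s = ∫ r in (0:ℝ)..s, (sigbar r) ^ 2)

/-- `γ* = 𝒥_{σ²/σ̄}(1)`. -/
def gammaStar (M : ℕ) (sigv lamv : ℕ → ℝ) (sigbar : ℝ → ℝ) : ℝ :=
  ∫ s in (0:ℝ)..1, (stepFn M sigv lamv s) ^ 2 / sigbar s

/-- The critical levels `γ^l = ∫_0^1 σ²(s)/σ̄(s ∧ λ^l) ds`, `γ⁰ = 0`. -/
def gammaL (M : ℕ) (sigv lamv : ℕ → ℝ) (lamb : ℕ → ℝ) (sigbar : ℝ → ℝ) (l : ℕ) : ℝ :=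
  if l = 0 then 0 else ∫ s in (0:ℝ)..1, (stepFn M sigv lamv s) ^ 2 / sigbar (min s (lamb l))

/-- `EntE` is the entropy function `𝓔` of the model. -/
def IsEntropy (M : ℕ) (sigv lamv : ℕ → ℝ) (m : ℕ) (lamb : ℕ → ℝ) (sigbar : ℝ → ℝ)
    (EntE : ℝ → ℝ) : Prop :=
  EntE 0 = 1 ∧
  ∀ l ∈ Finset.Icc 1 m, ∀ γ : ℝ,
    gammaL M sigv lamv lamb sigbar (l - 1) < γ → γ ≤ gammaL M sigv lamv lamb sigbar l →
      EntE γ = (1 - lamb (l - 1)) -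
        (γ - ∫ s in (0:ℝ)..(lamb (l - 1)), (stepFn M sigv lamv s) ^ 2 / sigbar s) ^ 2 /
          Jint2 (fun r => (stepFn M sigv lamv r) ^ 2) (lamb (l - 1)) 1

/-- The limiting free energy of the `REM(σ)` model. -/
def fREM (σ β : ℝ) : ℝ :=
  if (2 / σ) < β then 2 * (β / (2 / σ)) else 1 + (β / (2 / σ)) ^ 2

/-- The index `l_β`. -/
def lbeta (m : ℕ) (sigb : ℕ → ℝ) (β : ℝ) : ℕ :=
  if β ≤ 2 / sigb m then sInf {l : ℕ | 1 ≤ l ∧ β ≤ 2 / sigb l} else m + 1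

/-- The limiting free energy `f^ψ(β)`, written with the `l_β` split. -/
def fpsiLim (m : ℕ) (sigb lamb : ℕ → ℝ) (β : ℝ) : ℝ :=
  (∑ j ∈ Finset.Icc 1 (lbeta m sigb β - 1), (2 * β / (2 / sigb j)) * (lamb j - lamb (j - 1))) +
  ∑ j ∈ Finset.Icc (lbeta m sigb β) m, (1 + β ^ 2 / (2 / sigb j) ^ 2) * (lamb j - lamb (j - 1))

/-- The set `ℬ` of non-critical inverse temperatures. -/
def critSet (m : ℕ) (sigb : ℕ → ℝ) : Set ℝ :=
  {β | 0 < β ∧ ∀ j ∈ Finset.Icc 1 m, β ≠ 2 / sigb j}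

/-- The partition function `Z_N^ψ(β)`. -/
def ZN (N M : ℕ) (sigv lamv : ℕ → ℝ) (P : MeasureTheory.Measure FieldSp) (β : ℝ) (ω : FieldSp) : ℝ :=
  ∑ v ∈ VN N, Real.exp (β * psiFld N M sigv lamv P v ω)

/-- The free energy `f_N^ψ(β)` on `V_N`. -/
def freeEnergy (N M : ℕ) (sigv lamv : ℕ → ℝ) (P : MeasureTheory.Measure FieldSp) (β : ℝ) (ω : FieldSp) : ℝ :=
  (Real.log ((N : ℝ) ^ 2))⁻¹ * Real.log (ZN N M sigv lamv P β ω)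

/-- The set `A_{N,ρ}` of points at distance at least `N^{1−ρ}` from `ℤ² ∖ V_N`. -/
def AN (N : ℕ) (ρ : ℝ) : Finset Vtx :=
  (VN N).filter fun v => ∀ z : Vtx, z ∉ VN N →
    (N : ℝ) ^ ((1 : ℝ) - ρ) ≤ Real.sqrt (((v.1 : ℝ) - (z.1 : ℝ)) ^ 2 + ((v.2 : ℝ) - (z.2 : ℝ)) ^ 2)

/-- The restricted partition function `Z_{N,ρ}^ψ(β)`. -/
def ZNres (N M : ℕ) (sigv lamv : ℕ → ℝ) (P : MeasureTheory.Measure FieldSp) (β ρ : ℝ) (ω : FieldSp) : ℝ :=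
  ∑ v ∈ AN N ρ, Real.exp (β * psiFld N M sigv lamv P v ω)

/-- The free energy `f_{N,ρ}^ψ(β)` on `A_{N,ρ}`. -/
def freeEnergyRes (N M : ℕ) (sigv lamv : ℕ → ℝ) (P : MeasureTheory.Measure FieldSp) (β ρ : ℝ)
    (ω : FieldSp) : ℝ :=
  (Real.log ((N : ℝ) ^ 2))⁻¹ * Real.log (ZNres N M sigv lamv P β ρ ω)

/-- The Gibbs weight `𝒢_{β,N}({v})`. -/
def gibbsW (N M : ℕ) (sigv lamv : ℕ → ℝ) (P : MeasureTheory.Measure FieldSp) (β : ℝ) (v : Vtx)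
    (ω : FieldSp) : ℝ :=
  Real.exp (β * psiFld N M sigv lamv P v ω) / ZN N M sigv lamv P β ω

/-- The restricted Gibbs weight `𝒢_{β,N,ρ}({v})`. -/
def gibbsWres (N M : ℕ) (sigv lamv : ℕ → ℝ) (P : MeasureTheory.Measure FieldSp) (β ρ : ℝ) (v : Vtx)
    (ω : FieldSp) : ℝ :=
  Real.exp (β * psiFld N M sigv lamv P v ω) / ZNres N M sigv lamv P β ρ ω

/-- `E𝒢_{β,N}^{×s}[F]`: the mean over the disorder of the `s`-fold Gibbs average of `F`. -/
def gibbsExp (N M : ℕ) (sigv lamv : ℕ → ℝ) (P : MeasureTheory.Measure FieldSp) (β : ℝ) (s : ℕ)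
    (F : (Fin s → Vtx) → ℝ) : ℝ :=
  ∫ ω, (∑ vv ∈ Fintype.piFinset (fun _ : Fin s => VN N),
    (∏ i, gibbsW N M sigv lamv P β (vv i) ω) * F vv) ∂P

/-- `E𝒢_{β,N,ρ}^{×s}[F]`, with an `ω`-dependent integrand allowed. -/
def gibbsExpRes (N M : ℕ) (sigv lamv : ℕ → ℝ) (P : MeasureTheory.Measure FieldSp) (β ρ : ℝ) (s : ℕ)
    (F : (Fin s → Vtx) → FieldSp → ℝ) : ℝ :=
  ∫ ω, (∑ vv ∈ Fintype.piFinset (fun _ : Fin s => AN N ρ),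
    (∏ i, gibbsWres N M sigv lamv P β ρ (vv i) ω) * F vv ω) ∂P

/-- `E𝒢_{β,N}^{×s}[F]`, with an `ω`-dependent integrand allowed. -/
def gibbsExpW (N M : ℕ) (sigv lamv : ℕ → ℝ) (P : MeasureTheory.Measure FieldSp) (β : ℝ) (s : ℕ)
    (F : (Fin s → Vtx) → FieldSp → ℝ) : ℝ :=
  ∫ ω, (∑ vv ∈ Fintype.piFinset (fun _ : Fin s => VN N),
    (∏ i, gibbsW N M sigv lamv P β (vv i) ω) * F vv ω) ∂P

/-- The covariance `E[ψ_v ψ_{v'}]`. -/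
def psiCov (N M : ℕ) (sigv lamv : ℕ → ℝ) (P : MeasureTheory.Measure FieldSp) (v v' : Vtx) : ℝ :=
  ∫ ω, psiFld N M sigv lamv P v ω * psiFld N M sigv lamv P v' ω ∂P

/-- `C₀` is a constant witnessing the uniform variance upper bound
`max_{v∈V_N} E[ψ_v²] ≤ 𝒥_{σ²}(1) log N + C₀` for `N` large. -/
def IsVarBound (M : ℕ) (sigv lamv : ℕ → ℝ) (P : ℕ → MeasureTheory.Measure FieldSp) (C₀ : ℝ) : Prop :=
  0 < C₀ ∧ ∃ N₀ : ℕ, ∀ N ≥ N₀, ∀ v ∈ VN N,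
    psiCov N M sigv lamv (P N) v v ≤ Jsig2 M sigv lamv 1 * Real.log N + C₀

/-- The overlap `q^N(v,v')`. -/
def overlapQ (N M : ℕ) (sigv lamv : ℕ → ℝ) (P : MeasureTheory.Measure FieldSp) (C₀ : ℝ) (v v' : Vtx) : ℝ :=
  psiCov N M sigv lamv P v v' / (Jsig2 M sigv lamv 1 * Real.log N + C₀)

/-- Convergence in probability to a constant, for a sequence of random variables on a
sequence of probability spaces. -/
def TendstoInProb (P : ℕ → MeasureTheory.Measure FieldSp) (X : ℕ → FieldSp → ℝ) (c : ℝ) : Prop :=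
  ∀ ε : ℝ, 0 < ε → Tendsto (fun N => P N {ω | ε < |X N ω - c|}) atTop (nhds 0)

/-- Convergence in `L^p` to a constant. -/
def TendstoLp (P : ℕ → MeasureTheory.Measure FieldSp) (X : ℕ → FieldSp → ℝ) (p c : ℝ) : Prop :=
  Tendsto (fun N => ∫ ω, |X N ω - c| ^ p ∂(P N)) atTop (nhds 0)

/-- The branching scale `b_N(v,v')`. -/
def bScale (N : ℕ) (v v' : Vtx) : ℝ :=
  sSup {lam : ℝ | lam ∈ Set.Icc (0:ℝ) 1 ∧ ((nbhd N lam v) ∩ (nbhd N lam v')).Nonempty}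

end GFFCommon



theorem arctan_diff_bounds (x y : ℝ) (hx : 0 ≤ x) (hxy : x ≤ y) :
    (y - x) / (1 + y ^ 2) ≤ Real.arctan y - Real.arctan x ∧
    Real.arctan y - Real.arctan x ≤ (y - x) / (1 + x ^ 2) := by
  rcases hxy.eq_or_lt with rfl | hlt
  · simp
  obtain ⟨c, hc, hc'⟩ := exists_deriv_eq_slope Real.arctan hlt
    Real.continuous_arctan.continuousOn Real.differentiable_arctan.differentiableOn
  rw [Real.deriv_arctan] at hc'
  have h0 : 0 < y - x := by linarith
  have h1 : Real.arctan y - Real.arctan x = (y - x) / (1 + c ^ 2) := by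
    field_simp at hc' ⊢
    linarith
  have hc1 := hc.1
  have hc2 := hc.2
  rw [h1]
  constructor
  · apply div_le_div_of_nonneg_left h0.le (by positivity)
    nlinarith
  · apply div_le_div_of_nonneg_left h0.le (by positivity)
    nlinarith

/-- inner sum -/
theorem inner_lower (p : ℝ) (hp : 0 < p) (m : ℕ) :
    Real.arctan ((2 * m + 1) / p) - Real.arctan (1 / p) ≤
      ∑ k ∈ Finset.range m, 2 * p / (p ^ 2 + (2 * (k:ℝ) + 1) ^ 2) := by
  induction m with
  | zero => simp
  | succ m ih =>
    rw [Finset.sum_range_succ]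
    have h := (arctan_diff_bounds ((2 * m + 1) / p) ((2 * (m + 1 : ℕ) + 1) / p)
      (by positivity) (by gcongr; linarith)).2
    have e : ((2 * ((m + 1 : ℕ):ℝ) + 1) / p - (2 * m + 1) / p) / (1 + ((2 * m + 1) / p) ^ 2)
      = 2 * p / (p ^ 2 + (2 * (m:ℝ) + 1) ^ 2) := by
      push_cast
      field_simp
      ring
    rw [e] at h
    linarith

theorem inner_upper (p : ℝ) (hp : 0 < p) (m : ℕ) :
      ∑ k ∈ Finset.range (m+1), 2 * p / (p ^ 2 + (2 * (k:ℝ) + 1) ^ 2) ≤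
      2 / p + Real.arctan ((2 * m + 1) / p) := by
  induction m with
  | zero =>
    simp
    have : 0 ≤ Real.arctan p⁻¹ := Real.arctan_nonneg.2 (by positivity)
    have : 2 * p / (p ^ 2 + 1) ≤ 2 / p := by
      rw [div_le_div_iff₀ (by positivity) hp]; nlinarith
    linarith
  | succ m ih =>
    rw [Finset.sum_range_succ]
    have h := (arctan_diff_bounds ((2 * m + 1) / p) ((2 * (m + 1 : ℕ) + 1) / p)
      (by positivity) (by gcongr; linarith)).1
    have e : ((2 * ((m + 1 : ℕ):ℝ) + 1) / p - (2 * m + 1) / p) / (1 + ((2 * ((m+1:ℕ):ℝ) + 1) / p) ^ 2)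
      = 2 * p / (p ^ 2 + (2 * ((m+1:ℕ):ℝ) + 1) ^ 2) := by
      push_cast
      field_simp
      ring
    rw [e] at h
    linarith

/-- the double sum over odd pairs -/
noncomputable def Tsum (m : ℕ) : ℝ :=
  ∑ i ∈ Finset.range m, ∑ k ∈ Finset.range m, 1 / ((2 * (i:ℝ) + 1) ^ 2 + (2 * (k:ℝ) + 1) ^ 2)

theorem Tsum_succ (m : ℕ) : Tsum (m + 1) = Tsum m +
    (1 / (2 * (m:ℝ) + 1)) * (∑ k ∈ Finset.range m, 2 * (2 * (m:ℝ) + 1) / ((2 * (m:ℝ) + 1) ^ 2 + (2 * (k:ℝ) + 1) ^ 2))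
      + 1 / (2 * (2 * (m:ℝ) + 1) ^ 2) := by
  unfold Tsum
  rw [Finset.sum_range_succ]
  simp_rw [Finset.sum_range_succ]
  rw [Finset.sum_add_distrib, Finset.mul_sum]
  have : ∀ k : ℕ, 1 / (2 * (m:ℝ) + 1) * (2 * (2 * (m:ℝ) + 1) / ((2 * (m:ℝ) + 1) ^ 2 + (2 * (k:ℝ) + 1) ^ 2))
    = 1 / ((2 * (k:ℝ) + 1) ^ 2 + (2 * (m:ℝ) + 1) ^ 2) + 1 / ((2 * (m:ℝ) + 1) ^ 2 + (2 * (k:ℝ) + 1) ^ 2) := by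
    intro k
    rw [add_comm ((2 * (k:ℝ) + 1) ^ 2)]
    field_simp
    ring
  simp_rw [this]
  rw [Finset.sum_add_distrib]
  have e : 1 / (2 * (2 * (m:ℝ) + 1) ^ 2) = 1 / ((2 * (m:ℝ) + 1) ^ 2 + (2 * (m:ℝ) + 1) ^ 2) := by
    ring
  rw [e]
  ring

theorem Tsum_incr (m : ℕ) :
    |Tsum (m + 1) - Tsum m - Real.pi / (8 * (m + 1))| ≤ 4 / ((m:ℝ) + 1) ^ 2 := by
  rw [Tsum_succ]
  set p : ℝ := 2 * (m:ℝ) + 1 with hp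
  have hp0 : 0 < p := by positivity
  set S := ∑ k ∈ Finset.range m, 2 * p / (p ^ 2 + (2 * (k:ℝ) + 1) ^ 2) with hS
  have h1 := inner_lower p hp0 m
  rw [← hS, ← hp, div_self hp0.ne', Real.arctan_one] at h1
  have h2 : S ≤ 2 / p + Real.pi / 4 := by
    refine le_trans ?_ ((inner_upper p hp0 m).trans ?_)
    · rw [Finset.sum_range_succ]
      have : 0 ≤ 2 * p / (p ^ 2 + (2 * (m:ℝ) + 1) ^ 2) := by positivity
      linarith
    · rw [← hp, div_self hp0.ne', Real.arctan_one]
  have h3 : Real.arctan (1 / p) ≤ 1 / p := by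
    have := (arctan_diff_bounds 0 (1 / p) le_rfl (by positivity)).2
    simpa using this
  have hpi := Real.pi_pos
  have hpi4 := Real.pi_le_four
  have hq : 0 < (m:ℝ) + 1 := by positivity
  have hpq : (m:ℝ) + 1 ≤ p := by rw [hp]; linarith [(Nat.cast_nonneg m : (0:ℝ) ≤ m)]
  have e0 : 1 / p ≤ 1 / (m + 1) := by gcongr
  have e0' : 0 < 1 / p := by positivity
  have e1 : Real.pi / (8 * (m + 1)) = (1 / p) * (Real.pi / 4) - (Real.pi / 8) * ((1 / p) * (1 / (m + 1))) := by
    field_simp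
    rw [hp]; ring
  have e2 : 1 / (2 * p ^ 2) = (1 / 2) * ((1 / p) * (1 / p)) := by field_simp
  have e3 : 4 / ((m:ℝ) + 1) ^ 2 = 4 * ((1 / (m + 1)) * (1 / (m + 1))) := by field_simp
  have e4 : 2 / p = 2 * (1 / p) := by ring
  rw [e1, e2, e3]
  rw [e4] at h2
  set a := 1 / p
  set b := 1 / ((m:ℝ) + 1)
  have g1 : a * a ≤ b * b := by nlinarith
  have g2 : a * b ≤ b * b := by nlinarith
  have g3 : 0 ≤ a * b := by nlinarith
  have g4 : 0 ≤ a * a := by nlinarith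
  have g5 : a * S ≤ a * (2 * a + Real.pi / 4) := by gcongr
  have g6 : a * (Real.pi / 4 - a) ≤ a * S := by gcongr; linarith
  rw [abs_le]
  constructor
  · nlinarith
  · nlinarith

theorem Tsum_harmonic (m : ℕ) (hm : 1 ≤ m) :
    |Tsum m - Real.pi / 8 * (harmonic m : ℝ)| ≤ 8 - 4 / m := by
  induction m, hm using Nat.le_induction with
  | base =>
    have h := Tsum_incr 0
    simp [Tsum] at h ⊢
    norm_num at h ⊢
    exact h
  | succ m hm ih =>
    have h := Tsum_incr m
    rw [harmonic_succ]
    push_cast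
    have hm0 : (0:ℝ) < m := by exact_mod_cast hm
    have e : 4 / ((m:ℝ) + 1) ^ 2 ≤ 4 / m - 4 / (m + 1) := by
      rw [div_sub_div _ _ (by positivity) (by positivity), div_le_div_iff₀ (by positivity) (by positivity)]
      nlinarith
    have e2 : Tsum (m + 1) - Real.pi / 8 * ((harmonic m : ℝ) + ((m:ℝ) + 1)⁻¹)
      = (Tsum (m + 1) - Tsum m - Real.pi / (8 * (m + 1))) + (Tsum m - Real.pi / 8 * (harmonic m : ℝ)) := by
      field_simp; ring
    rw [e2]
    refine (abs_add_le _ _).trans ?_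
    linarith

theorem Tsum_log (m : ℕ) (hm : 1 ≤ m) :
    |Tsum m - Real.pi / 8 * Real.log m| ≤ 9 := by
  have h := Tsum_harmonic m hm
  have hm0 : (0:ℝ) < m := by exact_mod_cast hm
  have h1 := harmonic_le_one_add_log m
  have h2 := log_add_one_le_harmonic m
  have h3 : Real.log m ≤ Real.log (m + 1 : ℕ) := Real.log_le_log hm0 (by push_cast; linarith)
  have h4 : 0 < 4 / (m:ℝ) := by positivity
  have hpi := Real.pi_pos
  have hpi4 := Real.pi_le_four
  have h5 : |Real.pi / 8 * (harmonic m : ℝ) - Real.pi / 8 * Real.log m| ≤ 1 := by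
    rw [abs_le]; constructor <;> nlinarith
  have := abs_sub_le (Tsum m) (Real.pi / 8 * (harmonic m : ℝ)) (Real.pi / 8 * Real.log m)
  linarith


/-- angle -/
noncomputable def thA (m j : ℕ) : ℝ := Real.pi * j / (2 * m)

noncomputable def DA (m j k : ℕ) : ℝ := 1 - (Real.cos (thA m j) + Real.cos (thA m k)) / 2

noncomputable def FA (m : ℕ) (u w : ℝ) : ℝ :=
  (2 * Real.pi / (2 * m) ^ 2) * ∑ j ∈ Finset.range (2 * m), ∑ k ∈ Finset.range (2 * m),
    (Real.sin (thA m j * u) * Real.sin (thA m j * m)) *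
      (Real.sin (thA m k * w) * Real.sin (thA m k * m)) / DA m j k

theorem thA_mem (m j : ℕ) (hm : 1 ≤ m) (hj : j < 2 * m) : 0 ≤ thA m j ∧ thA m j < Real.pi := by
  have hm0 : (0:ℝ) < m := by exact_mod_cast hm
  have hpi := Real.pi_pos
  have hj' : (j:ℝ) < 2 * m := by exact_mod_cast hj
  unfold thA
  refine ⟨by positivity, ?_⟩
  rw [div_lt_iff₀ (by positivity)]
  exact mul_lt_mul_of_pos_left hj' hpi

theorem one_sub_cos_lower (t : ℝ) (h0 : 0 ≤ t) (h1 : t ≤ Real.pi) :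
    2 / Real.pi ^ 2 * t ^ 2 ≤ 1 - Real.cos t := by
  have := Real.cos_le_one_sub_mul_cos_sq (x := t) (by rw [abs_of_nonneg h0]; exact h1)
  linarith

theorem DA_lower (m j k : ℕ) (hm : 1 ≤ m) (hj : j < 2 * m) (hk : k < 2 * m) :
    (1 / Real.pi ^ 2) * (thA m j ^ 2 + thA m k ^ 2) ≤ DA m j k := by
  have a := thA_mem m j hm hj
  have b := thA_mem m k hm hk
  have a' := one_sub_cos_lower _ a.1 a.2.le
  have b' := one_sub_cos_lower _ b.1 b.2.le
  have : 2 / Real.pi ^ 2 = 2 * (1 / Real.pi ^ 2) := by ring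
  rw [this] at a' b'
  unfold DA
  linarith

theorem thA_pos (m j : ℕ) (hm : 1 ≤ m) (hj : 1 ≤ j) : 0 < thA m j := by
  have hm0 : (0:ℝ) < m := by exact_mod_cast hm
  have hj0 : (0:ℝ) < j := by exact_mod_cast hj
  have hpi := Real.pi_pos
  unfold thA; positivity

theorem DA_pos (m j k : ℕ) (hm : 1 ≤ m) (hj : j < 2 * m) (hk : k < 2 * m) (hj1 : 1 ≤ j) :
    0 < DA m j k := by
  refine lt_of_lt_of_le ?_ (DA_lower m j k hm hj hk)
  have := thA_pos m j hm hj1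
  have hpi := Real.pi_pos
  positivity

theorem FA_poisson (m : ℕ) (hm : 1 ≤ m) (u w : ℝ) :
    FA m u w = (FA m (u + 1) w + FA m (u - 1) w + FA m u (w + 1) + FA m u (w - 1)) / 4 +
     (2 * Real.pi / (2 * m) ^ 2) *
      ((∑ j ∈ Finset.range (2 * m), Real.sin (thA m j * u) * Real.sin (thA m j * m)) *
      (∑ j ∈ Finset.range (2 * m), Real.sin (thA m j * w) * Real.sin (thA m j * m))) := by
  unfold FA
  generalize 2 * Real.pi / (2 * (m:ℝ)) ^ 2 = A
  rw [← mul_add, ← mul_add, ← mul_add, mul_div_assoc, ← mul_add]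
  congr 1
  rw [Finset.sum_mul_sum]
  simp_rw [← Finset.sum_add_distrib]
  rw [Finset.sum_div, ← Finset.sum_add_distrib]
  refine Finset.sum_congr rfl fun j hj => ?_
  rw [Finset.sum_div, ← Finset.sum_add_distrib]
  refine Finset.sum_congr rfl fun k hk => ?_
  rcases Nat.eq_zero_or_pos j with rfl | hj1
  · simp [thA]
  have hD := (DA_pos m j k hm (Finset.mem_range.1 hj) (Finset.mem_range.1 hk) hj1).ne'
  have e1 : DA m j k = 1 - (Real.cos (thA m j) + Real.cos (thA m k)) / 2 := rfl
  simp only [mul_add, mul_sub, mul_one, Real.sin_add, Real.sin_sub]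
  field_simp
  rw [e1]
  ring

theorem sum_cos_aux (t : ℝ) (n : ℕ) :
    2 * Real.sin (t / 2) * ∑ j ∈ Finset.range n, Real.cos (t * j) =
      Real.sin (t * n - t / 2) + Real.sin (t / 2) := by
  induction n with
  | zero => simp
  | succ n ih =>
    rw [Finset.sum_range_succ, mul_add, ih]
    have e1 : t * ((n + 1 : ℕ) : ℝ) - t / 2 = t * n + t / 2 := by push_cast; ring
    rw [e1, Real.sin_sub, Real.sin_add]
    ring

/-- sum of cosines at integer frequency -/
theorem sum_cos_int (m : ℕ) (hm : 1 ≤ m) (n : ℤ) (hn : n ≠ 0) (h1 : -(4 * m : ℤ) < n) (h2 : n < 4 * m) :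
    ∑ j ∈ Finset.range (2 * m), Real.cos (thA m j * n) = (1 - (-1) ^ n) / 2 := by
  have hm0 : (0:ℝ) < m := by exact_mod_cast hm
  have h := sum_cos_aux (Real.pi * n / (2 * m)) (2 * m)
  have hs : Real.sin (Real.pi * n / (2 * m) / 2) ≠ 0 := by
    rw [Real.sin_ne_zero_iff]
    intro k hk
    have hpi := Real.pi_pos
    have : (k:ℝ) * (4 * m) = n := by
      field_simp at hk
      nlinarith
    have h3 : k * (4 * m) = n := by exact_mod_cast this
    have hk0 : k ≠ 0 := by rintro rfl; simp at h3; exact hn h3.symm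
    have hmz : (1:ℤ) ≤ m := by exact_mod_cast hm
    rcases lt_or_gt_of_ne hk0 with hk | hk
    · nlinarith
    · nlinarith
  have e : ∀ j : ℕ, thA m j * n = Real.pi * n / (2 * m) * j := by
    intro j; unfold thA; ring
  simp_rw [e]
  have e2 : Real.pi * n / (2 * m) * ((2 * m : ℕ) : ℝ) = n * Real.pi := by
    push_cast; field_simp
  rw [e2] at h
  have e3 : Real.sin (n * Real.pi - Real.pi * n / (2 * m) / 2) = - ((-1) ^ n * Real.sin (Real.pi * n / (2 * m) / 2)) := by
    rw [Real.sin_int_mul_pi_sub]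
  rw [e3] at h
  have : 2 * Real.sin (Real.pi * n / (2 * m) / 2) * (∑ j ∈ Finset.range (2 * m), Real.cos (Real.pi * n / (2 * m) * j) - (1 - (-1) ^ n) / 2) = 0 := by
    rw [mul_sub, h]; ring
  rcases mul_eq_zero.1 this with h' | h'
  · exact absurd h' (mul_ne_zero two_ne_zero hs)
  · linarith

theorem sine_orth (m : ℕ) (hm : 1 ≤ m) (x : ℤ) (h1 : -(m:ℤ) < x) (h2 : x < m) :
    ∑ j ∈ Finset.range (2 * m), Real.sin (thA m j * ((x:ℝ) + m)) * Real.sin (thA m j * m) =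
      if x = 0 then (m:ℝ) else 0 := by
  have hm0 : (0:ℝ) < m := by exact_mod_cast hm
  have e : ∀ j : ℕ, Real.sin (thA m j * ((x:ℝ) + m)) * Real.sin (thA m j * m) =
    (Real.cos (thA m j * x) - Real.cos (thA m j * ((x + 2 * m : ℤ) : ℝ))) / 2 := by
    intro j
    push_cast
    have a1 : thA m j * x = thA m j * ((x:ℝ) + m) - thA m j * m := by ring
    have a2 : thA m j * (x + 2 * m) = thA m j * ((x:ℝ) + m) + thA m j * m := by ring
    rw [a1, a2, Real.cos_sub, Real.cos_add]
    ring
  simp_rw [e]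
  rw [← Finset.sum_div, Finset.sum_sub_distrib, sum_cos_int m hm (x + 2 * m) (by omega) (by omega) (by omega)]
  have par : ((-1:ℝ)) ^ (x + 2 * m) = (-1) ^ x := by
    rw [zpow_add₀ (by norm_num), zpow_mul]; simp
  rw [par]
  split_ifs with hx
  · subst hx; simp
  · rw [sum_cos_int m hm x hx (by omega) (by omega)]; simp

/-- the Green function of the box `(-m,m)^2` with pole at the origin -/
noncomputable def gBox (m : ℕ) (x : ℤ × ℤ) : ℝ :=
  if (-(m:ℤ) < x.1 ∧ x.1 < m) ∧ (-(m:ℤ) < x.2 ∧ x.2 < m) then FA m ((x.1:ℝ) + m) ((x.2:ℝ) + m) else 0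

theorem FA_bd (m : ℕ) (hm : 1 ≤ m) (u w : ℝ) (h : u = 0 ∨ u = 2 * m ∨ w = 0 ∨ w = 2 * m) : FA m u w = 0 := by
  have hm0 : (0:ℝ) < m := by exact_mod_cast hm
  have key : ∀ j : ℕ, Real.sin (thA m j * (2 * m)) = 0 := by
    intro j
    have : thA m j * (2 * m) = j * Real.pi := by unfold thA; field_simp
    rw [this, Real.sin_nat_mul_pi]
  unfold FA
  rcases h with rfl | rfl | rfl | rfl <;> simp [key]

theorem gBox_eq_FA (m : ℕ) (hm : 1 ≤ m) (x : ℤ × ℤ) (h1 : -(m:ℤ) ≤ x.1) (h2 : x.1 ≤ m)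
    (h3 : -(m:ℤ) ≤ x.2) (h4 : x.2 ≤ m) : gBox m x = FA m ((x.1:ℝ) + m) ((x.2:ℝ) + m) := by
  unfold gBox
  split_ifs with h
  · rfl
  · symm
    apply FA_bd m hm
    have : x.1 = -(m:ℤ) ∨ x.1 = m ∨ x.2 = -(m:ℤ) ∨ x.2 = m := by omega
    rcases this with h | h | h | h <;> rw [h] <;> push_cast
    · left; ring
    · right; left; ring
    · right; right; left; ring
    · right; right; right; ring

theorem gBox_zero (m : ℕ) (x : ℤ × ℤ) (h : ¬((-(m:ℤ) < x.1 ∧ x.1 < m) ∧ (-(m:ℤ) < x.2 ∧ x.2 < m))) :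
    gBox m x = 0 := by
  unfold gBox; rw [if_neg h]

theorem gBox_poisson (m : ℕ) (hm : 1 ≤ m) (x : ℤ × ℤ)
    (h : (-(m:ℤ) < x.1 ∧ x.1 < m) ∧ (-(m:ℤ) < x.2 ∧ x.2 < m)) :
    gBox m x = (gBox m (x.1 + 1, x.2) + gBox m (x.1 - 1, x.2)
        + gBox m (x.1, x.2 + 1) + gBox m (x.1, x.2 - 1)) / 4
      + (Real.pi / 2) * (if x = 0 then 1 else 0) := by
  have hm0 : (0:ℝ) < m := by exact_mod_cast hm
  obtain ⟨⟨h1, h2⟩, h3, h4⟩ := h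
  rw [gBox_eq_FA m hm x (by omega) (by omega) (by omega) (by omega),
    gBox_eq_FA m hm _ (by simp; omega) (by simp; omega) (by simp; omega) (by simp; omega),
    gBox_eq_FA m hm _ (by simp; omega) (by simp; omega) (by simp; omega) (by simp; omega),
    gBox_eq_FA m hm _ (by simp; omega) (by simp; omega) (by simp; omega) (by simp; omega),
    gBox_eq_FA m hm _ (by simp; omega) (by simp; omega) (by simp; omega) (by simp; omega)]
  rw [FA_poisson m hm, sine_orth m hm x.1 h1 h2, sine_orth m hm x.2 h3 h4]
  push_cast
  congr 1
  · ring_nf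
  · have : x = 0 ↔ x.1 = 0 ∧ x.2 = 0 := Prod.ext_iff
    by_cases a : x.1 = 0 <;> by_cases b : x.2 = 0 <;> simp [this, a, b]
    field_simp
    try norm_num

theorem sum_odd (m n : ℕ) (hm : 1 ≤ m) (f : ℕ → ℝ) :
    ∑ j ∈ Finset.range (2 * n), (Real.sin (thA m j * m) * Real.sin (thA m j * m)) * f j =
      ∑ i ∈ Finset.range n, f (2 * i + 1) := by
  have hm0 : (0:ℝ) < m := by exact_mod_cast hm
  induction n with
  | zero => simp
  | succ n ih =>
    rw [show 2 * (n + 1) = 2 * n + 1 + 1 by ring, Finset.sum_range_succ, Finset.sum_range_succ, ih,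
      Finset.sum_range_succ]
    have e1 : thA m (2 * n) * m = n * Real.pi := by unfold thA; push_cast; field_simp
    have e2 : thA m (2 * n + 1) * m = n * Real.pi + Real.pi / 2 := by
      unfold thA; push_cast; field_simp
    rw [e1, e2, Real.sin_nat_mul_pi, Real.sin_add_pi_div_two]
    have := Real.sin_sq_add_cos_sq (n * Real.pi)
    rw [Real.sin_nat_mul_pi] at this
    have e3 : Real.cos (n * Real.pi) * Real.cos (n * Real.pi) = 1 := by nlinarith
    rw [e3]; ring

theorem gBox_center (m : ℕ) (hm : 1 ≤ m) :
    gBox m 0 = (2 * Real.pi / (2 * m) ^ 2) *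
      ∑ i ∈ Finset.range m, ∑ k ∈ Finset.range m, 1 / DA m (2 * i + 1) (2 * k + 1) := by
  rw [gBox_eq_FA m hm 0 (by simp) (by simp) (by simp) (by simp)]
  simp only [Prod.fst_zero, Prod.snd_zero, Int.cast_zero, zero_add]
  unfold FA
  congr 1
  rw [← sum_odd m m hm (fun j => ∑ k ∈ Finset.range m, 1 / DA m j (2 * k + 1))]
  refine Finset.sum_congr rfl fun j _ => ?_
  rw [← sum_odd m m hm (fun k => 1 / DA m j k), Finset.mul_sum]
  refine Finset.sum_congr rfl fun k _ => ?_
  ring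

theorem inv_DA_bounds (m j k : ℕ) (hm : 1 ≤ m) (hj : j < 2 * m) (hk : k < 2 * m) (hj1 : 1 ≤ j) :
    |1 / DA m j k - 4 / (thA m j ^ 2 + thA m k ^ 2)| ≤ 2 := by
  have hD := DA_pos m j k hm hj hk hj1
  have hL := DA_lower m j k hm hj hk
  have ha := thA_pos m j hm hj1
  have hb := (thA_mem m k hm hk).1
  have hpi := Real.pi_pos
  have hU : DA m j k ≤ (thA m j ^ 2 + thA m k ^ 2) / 4 := by
    have := Real.one_sub_sq_div_two_le_cos (x := thA m j)
    have := Real.one_sub_sq_div_two_le_cos (x := thA m k)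
    unfold DA; linarith
  have hU2 : (thA m j ^ 2 + thA m k ^ 2) / 4 - DA m j k ≤ (thA m j ^ 2 + thA m k ^ 2) ^ 2 / 48 := by
    have c4 : ∀ t : ℝ, 0 ≤ t → t < Real.pi → Real.cos t ≤ 1 - t ^ 2 / 2 + t ^ 4 / 24 := by
      intro t h0 h1
      have hpi2 := Real.pi_lt_d2
      have e := Real.cos_two_mul (t / 2)
      rw [show 2 * (t / 2) = t by ring] at e
      have e1 := Real.sin_sq_add_cos_sq (t / 2)
      have e2 := Real.sin_ge_sub_cube (x := t / 2) (by linarith)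
      have e3 : 0 ≤ t / 2 - (t / 2) ^ 3 / 6 := by
        have : t / 2 - (t / 2) ^ 3 / 6 = t / 2 * (1 - t ^ 2 / 24) := by ring
        rw [this]
        apply mul_nonneg (by linarith)
        nlinarith
      have e4 := pow_le_pow_left₀ e3 e2 2
      have e5 : 0 ≤ t ^ 6 := by positivity
      nlinarith
    have := c4 (thA m j) ha.le (thA_mem m j hm hj).2
    have := c4 (thA m k) hb (thA_mem m k hm hk).2
    unfold DA
    nlinarith [mul_nonneg (sq_nonneg (thA m j)) (sq_nonneg (thA m k))]
  set s := thA m j ^ 2 + thA m k ^ 2 with hs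
  have hs0 : 0 < s := by positivity
  have e : 1 / DA m j k - 4 / s = (s / 4 - DA m j k) * 4 / (DA m j k * s) := by
    field_simp
  rw [e, abs_of_nonneg (div_nonneg (by nlinarith) (by positivity)), div_le_iff₀ (by positivity)]
  have hpi2 : Real.pi ^ 2 ≤ 12 := by
    have := Real.pi_lt_d2
    nlinarith
  have h5 : s / 12 ≤ DA m j k := by
    refine le_trans ?_ hL
    rw [div_eq_inv_mul, ← one_div]
    gcongr
  nlinarith

theorem gBox_log (m : ℕ) (hm : 1 ≤ m) : |gBox m 0 - Real.log m| ≤ 40 := by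
  have hm0 : (0:ℝ) < m := by exact_mod_cast hm
  have hpi := Real.pi_pos
  have hpi4 := Real.pi_le_four
  have hpi3 := Real.pi_gt_three
  have hT := Tsum_log m hm
  have main : (2 * Real.pi / (2 * m) ^ 2) * ∑ i ∈ Finset.range m, ∑ k ∈ Finset.range m,
      4 / (thA m (2 * i + 1) ^ 2 + thA m (2 * k + 1) ^ 2) = 8 / Real.pi * Tsum m := by
    unfold Tsum
    simp_rw [Finset.mul_sum]
    refine Finset.sum_congr rfl fun i _ => Finset.sum_congr rfl fun k _ => ?_
    unfold thA
    push_cast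
    have : 0 < (2 * (i:ℝ) + 1) ^ 2 + (2 * (k:ℝ) + 1) ^ 2 := by positivity
    have e : (Real.pi * (2 * (i:ℝ) + 1) / (2 * m)) ^ 2 + (Real.pi * (2 * (k:ℝ) + 1) / (2 * m)) ^ 2
      = (Real.pi / (2 * m)) ^ 2 * ((2 * (i:ℝ) + 1) ^ 2 + (2 * (k:ℝ) + 1) ^ 2) := by ring
    rw [e]
    field_simp
    norm_num
  have err : |gBox m 0 - 8 / Real.pi * Tsum m| ≤ Real.pi := by
    rw [← main, gBox_center m hm, ← mul_sub, abs_mul, abs_of_pos (by positivity)]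
    simp_rw [← Finset.sum_sub_distrib]
    have : |∑ i ∈ Finset.range m, ∑ k ∈ Finset.range m, (1 / DA m (2 * i + 1) (2 * k + 1) -
        4 / (thA m (2 * i + 1) ^ 2 + thA m (2 * k + 1) ^ 2))| ≤ (m:ℝ) * ((m:ℝ) * 2) := by
      refine (Finset.abs_sum_le_sum_abs _ _).trans ?_
      have : ∀ i ∈ Finset.range m, |∑ k ∈ Finset.range m, (1 / DA m (2 * i + 1) (2 * k + 1) -
        4 / (thA m (2 * i + 1) ^ 2 + thA m (2 * k + 1) ^ 2))| ≤ (m:ℝ) * 2 := by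
        intro i hi
        refine (Finset.abs_sum_le_sum_abs _ _).trans ?_
        refine (Finset.sum_le_card_nsmul _ _ 2 fun k hk => ?_).trans (by simp)
        have := Finset.mem_range.1 hi
        have := Finset.mem_range.1 hk
        exact inv_DA_bounds m _ _ hm (by omega) (by omega) (by omega)
      exact (Finset.sum_le_card_nsmul _ _ _ this).trans (by simp)
    refine (mul_le_mul_of_nonneg_left this (by positivity)).trans (le_of_eq ?_)
    field_simp
  have h2 : |8 / Real.pi * Tsum m - Real.log m| ≤ 24 := by
    have : 8 / Real.pi * Tsum m - Real.log m = 8 / Real.pi * (Tsum m - Real.pi / 8 * Real.log m) := by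
      field_simp
    rw [this, abs_mul, abs_of_pos (by positivity)]
    have : 8 / Real.pi ≤ 8 / 3 := by gcongr
    calc 8 / Real.pi * |Tsum m - Real.pi / 8 * Real.log m| ≤ 8 / 3 * 9 := by gcongr
      _ = 24 := by norm_num
  have := abs_sub_le (gBox m 0) (8 / Real.pi * Tsum m) (Real.log m)
  linarith


/-- (negative) discrete Laplacian -/
noncomputable def lapA (f : Vtx → ℝ) (x : Vtx) : ℝ :=
  f x - (f (x.1 + 1, x.2) + f (x.1 - 1, x.2) + f (x.1, x.2 + 1) + f (x.1, x.2 - 1)) / 4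

theorem lapA_eq (f : Vtx → ℝ) (x : Vtx) :
    lapA f x = f x - (f (x + (1, 0)) + f (x - (1, 0)) + f (x + (0, 1)) + f (x - (0, 1))) / 4 := by
  have e1 : x + (1, 0) = (x.1 + 1, x.2) := by ext <;> simp
  have e2 : x - (1, 0) = (x.1 - 1, x.2) := by ext <;> simp
  have e3 : x + (0, 1) = (x.1, x.2 + 1) := by ext <;> simp
  have e4 : x - (0, 1) = (x.1, x.2 - 1) := by ext <;> simp
  rw [e1, e2, e3, e4, lapA]

theorem summ_mul_left (f h : Vtx → ℝ) (hf : f.support.Finite) : Summable fun x => f x * h x :=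
  summable_of_hasFiniteSupport (hf.subset (Function.support_mul_subset_left f h))

theorem summ_mul_right (f h : Vtx → ℝ) (hf : f.support.Finite) : Summable fun x => h x * f x :=
  summable_of_hasFiniteSupport (hf.subset (Function.support_mul_subset_right h f))

theorem supp_shift (f : Vtx → ℝ) (hf : f.support.Finite) (e : Vtx) :
    (Function.support fun x => f (x + e)).Finite := by
  have : (Function.support fun x => f (x + e)) = (fun x => x + e) ⁻¹' f.support := by
    ext; simp
  rw [this]
  exact hf.preimage (add_left_injective e).injOn

theorem supp_shift' (f : Vtx → ℝ) (hf : f.support.Finite) (e : Vtx) :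
    (Function.support fun x => f (x - e)).Finite := by
  simpa [sub_eq_add_neg] using supp_shift f hf (-e)

theorem tsum_shift (f h : Vtx → ℝ) (e : Vtx) :
    ∑' x, f x * h (x + e) = ∑' x, f (x - e) * h x := by
  rw [← Equiv.tsum_eq (Equiv.addRight e) (fun x => f (x - e) * h x)]
  simp

theorem tsum_shift' (f h : Vtx → ℝ) (e : Vtx) :
    ∑' x, f x * h (x - e) = ∑' x, f (x + e) * h x := by
  simpa [sub_eq_add_neg] using tsum_shift f h (-e)

theorem sbp (f h : Vtx → ℝ) (hf : f.support.Finite) :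
    ∑' x, f x * lapA h x = ∑' x, lapA f x * h x := by
  have L : ∑' x, f x * lapA h x = ∑' x, f x * h x - (∑' x, f x * h (x + (1,0)) + ∑' x, f x * h (x - (1,0))
     + ∑' x, f x * h (x + (0,1)) + ∑' x, f x * h (x - (0,1))) / 4 := by
    rw [← (summ_mul_left f _ hf).tsum_add (summ_mul_left f _ hf),
      ← Summable.tsum_add ((summ_mul_left f _ hf).add (summ_mul_left f _ hf)) (summ_mul_left f _ hf),
      ← Summable.tsum_add (((summ_mul_left f _ hf).add (summ_mul_left f _ hf)).add (summ_mul_left f _ hf)) (summ_mul_left f _ hf),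
      ← tsum_div_const, ← Summable.tsum_sub (summ_mul_left f _ hf)
        (((((summ_mul_left f _ hf).add (summ_mul_left f _ hf)).add (summ_mul_left f _ hf)).add (summ_mul_left f _ hf)).div_const _)]
    refine tsum_congr fun x => ?_
    rw [lapA_eq]; ring
  have s1 := fun e => summ_mul_left _ h (supp_shift f hf e)
  have s2 := fun e => summ_mul_left _ h (supp_shift' f hf e)
  have R : ∑' x, lapA f x * h x = ∑' x, f x * h x - (∑' x, f (x + (1,0)) * h x + ∑' x, f (x - (1,0)) * h x
     + ∑' x, f (x + (0,1)) * h x + ∑' x, f (x - (0,1)) * h x) / 4 := by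
    rw [← (s1 _).tsum_add (s2 _),
      ← Summable.tsum_add ((s1 _).add (s2 _)) (s1 _),
      ← Summable.tsum_add (((s1 _).add (s2 _)).add (s1 _)) (s2 _),
      ← tsum_div_const, ← Summable.tsum_sub (summ_mul_left f _ hf)
        (((((s1 _).add (s2 _)).add (s1 _)).add (s2 _)).div_const _)]
    refine tsum_congr fun x => ?_
    rw [lapA_eq]; ring
  rw [L, R, tsum_shift, tsum_shift, tsum_shift', tsum_shift']
  ring

theorem dirichlet_nonneg (f : Vtx → ℝ) (hf : f.support.Finite) : 0 ≤ ∑' x, lapA f x * f x := by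
  have s0 := summ_mul_left f f hf
  have key : ∀ e : Vtx, ∑' x, f (x + e) * f x ≤ ∑' x, f x * f x := by
    intro e
    have h1 : ∑' x, f (x + e) * f (x + e) = ∑' x, f x * f x :=
      Equiv.tsum_eq (Equiv.addRight e) (fun x => f x * f x)
    have s1 := summ_mul_left _ (fun x => f (x + e)) (supp_shift f hf e)
    have h2 : ∑' x, f (x + e) * f x ≤ ∑' x, (f (x + e) * f (x + e) + f x * f x) / 2 := by
      refine Summable.tsum_le_tsum (fun x => ?_) (summ_mul_left _ f (supp_shift f hf e)) ((s1.add s0).div_const _)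
      nlinarith [sq_nonneg (f (x + e) - f x)]
    rw [tsum_div_const, s1.tsum_add s0, h1] at h2
    linarith
  have s1 := fun e => summ_mul_left _ f (supp_shift f hf e)
  have s2 := fun e => summ_mul_left _ f (supp_shift' f hf e)
  have R : ∑' x, lapA f x * f x = ∑' x, f x * f x - (∑' x, f (x + (1,0)) * f x + ∑' x, f (x - (1,0)) * f x
     + ∑' x, f (x + (0,1)) * f x + ∑' x, f (x - (0,1)) * f x) / 4 := by
    rw [← (s1 _).tsum_add (s2 _),
      ← Summable.tsum_add ((s1 _).add (s2 _)) (s1 _),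
      ← Summable.tsum_add (((s1 _).add (s2 _)).add (s1 _)) (s2 _),
      ← tsum_div_const, ← Summable.tsum_sub (summ_mul_left f _ hf)
        (((((s1 _).add (s2 _)).add (s1 _)).add (s2 _)).div_const _)]
    refine tsum_congr fun x => ?_
    rw [lapA_eq]; ring
  rw [R]
  have a1 := key (1,0)
  have a2 := key (-(1,0))
  have a3 := key (0,1)
  have a4 := key (-(0,1))
  simp only [← sub_eq_add_neg] at a2 a4
  linarith

/-- covariance bilinear form -/
noncomputable def BF (V : Finset Vtx) (G : Vtx → Vtx → ℝ) (c d : Vtx → ℝ) : ℝ :=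
  ∑ v ∈ V, ∑ w ∈ V, c v * d w * G v w

noncomputable def UF (V : Finset Vtx) (G : Vtx → Vtx → ℝ) (d : Vtx → ℝ) (x : Vtx) : ℝ :=
  ∑ w ∈ V, G x w * d w

theorem intr_sub (V : Finset Vtx) : intr V ⊆ V := Finset.sdiff_subset

theorem UF_zero {V : Finset Vtx} {G : Vtx → Vtx → ℝ} (hG : IsGreenFn V G) (d : Vtx → ℝ) (x : Vtx)
    (hx : x ∉ intr V) : UF V G d x = 0 := by
  unfold UF
  exact Finset.sum_eq_zero fun w _ => by rw [hG.1 x w (Or.inl hx), zero_mul]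

theorem UF_supp {V : Finset Vtx} {G : Vtx → Vtx → ℝ} (hG : IsGreenFn V G) (d : Vtx → ℝ) :
    (UF V G d).support.Finite := by
  refine (intr V).finite_toSet.subset fun x hx => ?_
  by_contra h
  exact hx (UF_zero hG d x h)

theorem lapA_UF {V : Finset Vtx} {G : Vtx → Vtx → ℝ} (hG : IsGreenFn V G) (d : Vtx → ℝ) (x : Vtx)
    (hx : x ∈ intr V) : lapA (UF V G d) x = Real.pi / 2 * d x := by
  unfold lapA UF
  rw [← Finset.sum_add_distrib, ← Finset.sum_add_distrib, ← Finset.sum_add_distrib, Finset.sum_div,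
    ← Finset.sum_sub_distrib]
  rw [Finset.sum_eq_single x]
  · have := hG.2 x hx x hx
    rw [if_pos rfl] at this
    linear_combination d x * this
  · intro w _ hw
    by_cases hwi : w ∈ intr V
    · have := hG.2 w hwi x hx
      rw [if_neg hw.symm] at this
      linear_combination d w * this
    · simp [hG.1 _ w (Or.inr hwi)]
  · intro h; exact absurd (intr_sub V hx) h

theorem BF_U {V : Finset Vtx} {G : Vtx → Vtx → ℝ} (c d : Vtx → ℝ) :
    BF V G c d = ∑ v ∈ V, c v * UF V G d v := by
  unfold BF UF
  refine Finset.sum_congr rfl fun v _ => ?_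
  rw [Finset.mul_sum]
  exact Finset.sum_congr rfl fun w _ => by ring

theorem BF_tsum {V : Finset Vtx} {G : Vtx → Vtx → ℝ} (hG : IsGreenFn V G) (c d : Vtx → ℝ) :
    BF V G c d = ∑' x, c x * UF V G d x := by
  rw [BF_U, tsum_eq_sum]
  intro x hx
  rw [UF_zero hG d x (fun h => hx (intr_sub V h)), mul_zero]

theorem BF_lap {V : Finset Vtx} {G : Vtx → Vtx → ℝ} (hG : IsGreenFn V G) (c d : Vtx → ℝ) :
    BF V G c d = 2 / Real.pi * ∑' x, lapA (UF V G c) x * UF V G d x := by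
  rw [BF_tsum hG, ← tsum_mul_left]
  refine tsum_congr fun x => ?_
  by_cases hx : x ∈ intr V
  · rw [lapA_UF hG c x hx]
    have := Real.pi_pos
    field_simp
  · rw [UF_zero hG d x hx]; simp

theorem BF_symm {V : Finset Vtx} {G : Vtx → Vtx → ℝ} (hG : IsGreenFn V G) (c d : Vtx → ℝ) :
    BF V G c d = BF V G d c := by
  rw [BF_lap hG, BF_lap hG d c, ← sbp _ _ (UF_supp hG c)]
  congr 1
  exact tsum_congr fun x => mul_comm _ _

theorem BF_nonneg {V : Finset Vtx} {G : Vtx → Vtx → ℝ} (hG : IsGreenFn V G) (c : Vtx → ℝ) :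
    0 ≤ BF V G c c := by
  rw [BF_lap hG]
  have := Real.pi_pos
  exact mul_nonneg (by positivity) (dirichlet_nonneg _ (UF_supp hG c))

/-- pairing of `(2/π) (-Δ) g` -/
theorem BF_green {V : Finset Vtx} {G : Vtx → Vtx → ℝ} (hG : IsGreenFn V G) (g d : Vtx → ℝ)
    (hg : ∀ x, x ∉ intr V → g x = 0) :
    BF V G (fun x => 2 / Real.pi * lapA g x) d = ∑ x ∈ V, g x * d x := by
  have hgs : g.support.Finite := by
    refine (intr V).finite_toSet.subset fun x hx => ?_
    by_contra h
    exact hx (hg x h)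
  rw [BF_tsum hG]
  simp_rw [mul_assoc]
  rw [tsum_mul_left, ← sbp _ _ hgs, ← tsum_mul_left]
  have e : ∑' x, g x * d x = ∑ x ∈ V, g x * d x := by
    apply tsum_eq_sum
    intro x hx
    rw [hg x (fun h => hx (intr_sub V h)), zero_mul]
  rw [← e]
  · refine tsum_congr fun x => ?_
    by_cases hx : x ∈ intr V
    · rw [lapA_UF hG d x hx]
      have := Real.pi_pos
      field_simp
    · rw [hg x hx]; simp

theorem BF_add_left {V : Finset Vtx} {G : Vtx → Vtx → ℝ} (c c' d : Vtx → ℝ) :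
    BF V G (c + c') d = BF V G c d + BF V G c' d := by
  unfold BF
  simp_rw [← Finset.sum_add_distrib]
  refine Finset.sum_congr rfl fun v _ => Finset.sum_congr rfl fun w _ => ?_
  simp only [Pi.add_apply]; ring

theorem BF_sub_left {V : Finset Vtx} {G : Vtx → Vtx → ℝ} (c c' d : Vtx → ℝ) :
    BF V G (c - c') d = BF V G c d - BF V G c' d := by
  unfold BF
  simp_rw [← Finset.sum_sub_distrib]
  refine Finset.sum_congr rfl fun v _ => Finset.sum_congr rfl fun w _ => ?_
  simp only [Pi.sub_apply]; ring

theorem BF_expand_add {V : Finset Vtx} {G : Vtx → Vtx → ℝ} (hG : IsGreenFn V G) (c d : Vtx → ℝ) :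
    BF V G (c + d) (c + d) = BF V G c c + 2 * BF V G c d + BF V G d d := by
  rw [BF_add_left, BF_symm hG c (c + d), BF_symm hG d (c + d), BF_add_left, BF_add_left, BF_symm hG d c]
  ring

theorem BF_expand_sub {V : Finset Vtx} {G : Vtx → Vtx → ℝ} (hG : IsGreenFn V G) (c d : Vtx → ℝ) :
    BF V G (c - d) (c - d) = BF V G c c - 2 * BF V G d c + BF V G d d := by
  rw [BF_sub_left, BF_symm hG c (c - d), BF_symm hG d (c - d), BF_sub_left, BF_sub_left, BF_symm hG d c]
  ring


section GaussPart
open MeasureTheory ProbabilityTheory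

/-- linear functional of the field -/
noncomputable def XF (V : Finset Vtx) (c : Vtx → ℝ) (ω : FieldSp) : ℝ := ∑ v ∈ V, c v * ω v

theorem XF_meas (V : Finset Vtx) (c : Vtx → ℝ) : Measurable (XF V c) := by
  unfold XF
  fun_prop

theorem XF_add (V : Finset Vtx) (c d : Vtx → ℝ) (ω : FieldSp) : XF V (c + d) ω = XF V c ω + XF V d ω := by
  unfold XF
  rw [← Finset.sum_add_distrib]
  exact Finset.sum_congr rfl fun v _ => by simp only [Pi.add_apply]; ring

theorem XF_sub (V : Finset Vtx) (c d : Vtx → ℝ) (ω : FieldSp) : XF V (c - d) ω = XF V c ω - XF V d ω := by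
  unfold XF
  rw [← Finset.sum_sub_distrib]
  exact Finset.sum_congr rfl fun v _ => by simp only [Pi.sub_apply]; ring

theorem XF_single (V : Finset Vtx) (v : Vtx) (hv : v ∈ V) (ω : FieldSp) : XF V (Pi.single v 1) ω = ω v := by
  unfold XF
  rw [Finset.sum_eq_single v]
  · simp
  · intro w _ hw; simp [Pi.single_eq_of_ne hw]
  · intro h; exact absurd hv h

/-- hypothesis on a Gaussian law with covariance `G` -/
structure GLaw (V : Finset Vtx) (G : Vtx → Vtx → ℝ) (P : Measure FieldSp) : Prop where
  prob : IsProbabilityMeasure P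
  green : IsGreenFn V G
  law : ∀ c : Vtx → ℝ, P.map (XF V c) = gaussianReal 0 (Real.toNNReal (BF V G c c))

variable {V : Finset Vtx} {G : Vtx → Vtx → ℝ} {P : Measure FieldSp}

theorem GLaw.gauss (h : GLaw V G P) (c : Vtx → ℝ) : HasGaussianLaw (XF V c) P :=
  ⟨by rw [h.law c]; infer_instance⟩

theorem GLaw.memLp (h : GLaw V G P) (c : Vtx → ℝ) : MemLp (XF V c) 2 P := (h.gauss c).memLp_two

theorem GLaw.mean (h : GLaw V G P) (c : Vtx → ℝ) : ∫ ω, XF V c ω ∂P = 0 := by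
  have := integral_map (μ := P) (XF_meas V c).aemeasurable (f := fun x : ℝ => x) (by fun_prop)
  rw [← this, h.law c, integral_id_gaussianReal]

theorem GLaw.sq (h : GLaw V G P) (c : Vtx → ℝ) : ∫ ω, XF V c ω ^ 2 ∂P = BF V G c c := by
  have hp := h.prob
  have h1 : Var[XF V c; P] = BF V G c c := by
    have := variance_map (μ := P) (X := fun x : ℝ => x) (Y := XF V c) (by fun_prop) (XF_meas V c).aemeasurable
    have e : (fun x : ℝ => x) ∘ XF V c = XF V c := rfl
    rw [e] at this
    rw [← this, h.law c, variance_fun_id_gaussianReal, Real.coe_toNNReal _ (BF_nonneg h.green c)]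
  rw [← h1, variance_of_integral_eq_zero (XF_meas V c).aemeasurable (h.mean c)]

theorem GLaw.cov (h : GLaw V G P) (c d : Vtx → ℝ) : cov[XF V c, XF V d; P] = BF V G c d := by
  have hp := h.prob
  rw [covariance_eq_sub (h.memLp c) (h.memLp d), h.mean c, zero_mul, sub_zero]
  have h1 := h.sq (c + d)
  have e : ∀ ω, XF V (c + d) ω ^ 2 = XF V c ω ^ 2 + 2 * (XF V c * XF V d) ω + XF V d ω ^ 2 := by
    intro ω; rw [XF_add, Pi.mul_apply]; ring
  simp_rw [e] at h1
  have i1 := (h.memLp c).integrable_sq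
  have i2 := (h.memLp d).integrable_sq
  have i3 : Integrable (XF V c * XF V d) P := (h.memLp c).integrable_mul (h.memLp d)
  have j3 : Integrable (fun ω => 2 * (XF V c * XF V d) ω) P := i3.const_mul 2
  have j4 : Integrable (fun ω => XF V c ω ^ 2 + 2 * (XF V c * XF V d) ω) P := i1.add j3
  rw [integral_add j4 i2, integral_add i1 j3, integral_const_mul, h.sq, h.sq,
    BF_expand_add h.green] at h1
  linarith

theorem GLaw.process (h : GLaw V G P) : IsGaussianProcess (fun c : Vtx → ℝ => XF V c) P where
  hasGaussianLaw I := by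
    have hp := h.prob
    constructor
    apply isGaussian_of_map_eq_gaussianReal
    intro L
    refine ⟨0, Real.toNNReal (BF V G (fun v => ∑ i : I, i.1 v * L (Pi.single i 1)) (fun v => ∑ i : I, i.1 v * L (Pi.single i 1))), ?_⟩
    · rw [Measure.map_map (by fun_prop)]
      · have e : (L ∘ fun ω => I.restrict fun c => XF V c ω) =
          XF V (fun v => ∑ i : I, i.1 v * L (Pi.single i 1)) := by
          funext ω
          simp only [Function.comp_apply]
          have : (I.restrict fun c => XF V c ω) = ∑ i : I, XF V i.1 ω • (Pi.single i (1:ℝ) : I → ℝ) := by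
            funext j
            simp [Finset.sum_apply, Pi.single_apply]
          rw [this, map_sum]
          simp only [map_smul, smul_eq_mul]
          unfold XF
          simp_rw [Finset.sum_mul]
          rw [Finset.sum_comm]
          refine Finset.sum_congr rfl fun v _ => Finset.sum_congr rfl fun i _ => by ring
        rw [e]
        exact h.law _
      · exact measurable_pi_lambda _ fun i => XF_meas V i.1

/-- the σ-algebra generated by field values on `W` -/
def algOn (W : Set Vtx) : MeasurableSpace FieldSp :=
  ⨆ w ∈ W, MeasurableSpace.comap (fun ω : FieldSp => ω w) inferInstance

theorem algOn_le (W : Set Vtx) : algOn W ≤ MeasurableSpace.pi := by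
  refine iSup₂_le fun w _ => ?_
  exact (measurable_pi_apply w).comap_le

theorem algOn_mono {W W' : Set Vtx} (h : W ⊆ W') : algOn W ≤ algOn W' :=
  biSup_mono h

theorem algOn_eval (W : Set Vtx) (w : Vtx) (hw : w ∈ W) : Measurable[algOn W] (fun ω : FieldSp => ω w) := by
  have : MeasurableSpace.comap (fun ω : FieldSp => ω w) inferInstance ≤ algOn W :=
    le_iSup₂_of_le (f := fun w (_ : w ∈ W) => MeasurableSpace.comap (fun ω : FieldSp => ω w) inferInstance) w hw le_rfl
  exact Measurable.mono (comap_measurable _) this le_rfl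

theorem algOn_le_comap (W : Set Vtx) :
    algOn W ≤ MeasurableSpace.comap (fun (ω : FieldSp) (w : W) => ω w.1) inferInstance := by
  refine iSup₂_le fun w hw => ?_
  rintro s ⟨t, ht, rfl⟩
  exact ⟨(fun f : W → ℝ => f ⟨w, hw⟩) ⁻¹' t, (measurable_pi_apply _) ht, rfl⟩

theorem GLaw.condExp_eq (h : GLaw V G P) (S : Finset Vtx) (hS : S ⊆ intr V) (v : Vtx) (hv : v ∈ V)
    (g : Vtx → ℝ) (hg0 : ∀ x, x ∉ S → g x = 0)
    (hg : ∀ x ∈ S, lapA g x = Real.pi / 2 * (if x = v then 1 else 0)) :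
    P[fun ω : FieldSp => ω v | algOn {w | w ∈ V ∧ w ∉ S}] =ᵐ[P]
      fun ω => ω v - XF V (fun x => 2 / Real.pi * lapA g x) ω := by
  have hp := h.prob
  set W : Set Vtx := {w | w ∈ V ∧ w ∉ S} with hW
  set c : Vtx → ℝ := fun x => 2 / Real.pi * lapA g x with hc
  have hgV : ∀ x, x ∉ intr V → g x = 0 := fun x hx => hg0 x fun hxS => hx (hS hxS)
  have hcov : ∀ w : W, cov[XF V c, XF V (Pi.single w.1 1); P] = 0 := by
    intro w
    rw [h.cov, hc, BF_green h.green g _ hgV]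
    refine Finset.sum_eq_zero fun x _ => ?_
    by_cases hx : x = w.1
    · rw [hg0 x (hx ▸ w.2.2), zero_mul]
    · rw [Pi.single_eq_of_ne hx, mul_zero]
  have hind : IndepFun (fun ω (_ : Unit) => XF V c ω) (fun ω (w : W) => XF V (Pi.single w.1 1) ω) P := by
    apply IsGaussianProcess.indepFun_of_covariance_eq_zero (X := fun (_ : Unit) => XF V c)
      (Y := fun w : W => XF V (Pi.single w.1 1))
    · have := h.process.comp_right (S := Unit ⊕ W) (Sum.elim (fun _ => c) (fun w => Pi.single w.1 1))
      have e : ((fun c => XF V c) ∘ Sum.elim (fun _ => c) fun w : W => Pi.single w.1 1) =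
          Sum.elim (fun (_ : Unit) => XF V c) (fun w : W => XF V (Pi.single w.1 1)) := by
        funext s
        rcases s with s | s <;> rfl
      rw [e] at this
      exact this
    · exact fun _ => (XF_meas V _).aemeasurable
    · exact fun _ => (XF_meas V _).aemeasurable
    · exact fun _ w => hcov w
  have hind2 : IndepFun (XF V c) (fun (ω : FieldSp) (w : W) => ω w.1) P := by
    have e : (fun ω (w : W) => XF V (Pi.single w.1 1) ω) = (fun (ω : FieldSp) (w : W) => ω w.1) := by
      funext ω w; exact XF_single V w.1 w.2.1 ω
    rw [e] at hind
    exact hind.comp (φ := fun f : Unit → ℝ => f ()) (ψ := id) (measurable_pi_apply _) measurable_id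
  have hind3 : Indep (MeasurableSpace.comap (XF V c) inferInstance) (algOn W) P :=
    indep_of_indep_of_le_right ((IndepFun_iff_Indep _ _ _).1 hind2) (algOn_le_comap W)
  have hY : P[XF V c | algOn W] =ᵐ[P] fun _ => 0 := by
    have := condExp_indep_eq (f := XF V c) (XF_meas V c).comap_le (algOn_le W)
      (comap_measurable _).stronglyMeasurable hind3
    rw [h.mean c] at this
    exact this
  have hmZ : StronglyMeasurable[algOn W] (XF V (Pi.single v 1 - c)) := by
    have e : XF V (Pi.single v 1 - c) = fun ω => ∑ x ∈ V.filter (· ∉ S), ((Pi.single v 1 - c : Vtx → ℝ) x) * ω x := by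
      funext ω
      unfold XF
      rw [Finset.sum_filter]
      refine Finset.sum_congr rfl fun x hx => ?_
      by_cases hxS : x ∉ S
      · rw [if_pos hxS]
      · rw [if_neg hxS]
        have := hg x (not_not.1 hxS)
        simp only [Pi.sub_apply, hc, this]
        have hpi := Real.pi_pos
        by_cases hxv : x = v
        · subst hxv
          rw [if_pos rfl, Pi.single_eq_same]
          field_simp
          ring
        · simp [hxv]
    rw [e]
    apply Measurable.stronglyMeasurable
    refine Finset.measurable_sum _ fun x hx => ?_
    rw [Finset.mem_filter] at hx
    exact (algOn_eval W x hx).const_mul _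
  have i1 : Integrable (XF V c) P := (h.memLp c).integrable (by norm_num)
  have i2 : Integrable (XF V (Pi.single v 1 - c)) P := (h.memLp _).integrable (by norm_num)
  have e1 : (fun ω : FieldSp => ω v) = XF V c + XF V (Pi.single v 1 - c) := by
    funext ω
    rw [Pi.add_apply, XF_sub, XF_single V v hv]; ring
  have h2 := condExp_add i1 i2 (algOn W)
  rw [condExp_of_stronglyMeasurable (algOn_le W) hmZ i2] at h2
  rw [e1]
  filter_upwards [h2, hY] with ω a b
  rw [a, Pi.add_apply, b, XF_sub, XF_single V v hv]
  ring

end GaussPart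


section FinalPart
open MeasureTheory ProbabilityTheory

theorem mem_intr_iff (B : Finset Vtx) (x : Vtx) : x ∈ intr B ↔ x ∈ B ∧
    ((x.1 + 1, x.2) ∈ B ∧ (x.1 - 1, x.2) ∈ B ∧ (x.1, x.2 + 1) ∈ B ∧ (x.1, x.2 - 1) ∈ B) := by
  unfold intr bdry
  rw [Finset.mem_sdiff, Finset.mem_filter]
  tauto

theorem intr_mono {A B : Finset Vtx} (h : A ⊆ B) : intr A ⊆ intr B := by
  intro x hx
  rw [mem_intr_iff] at hx ⊢
  exact ⟨h hx.1, h hx.2.1, h hx.2.2.1, h hx.2.2.2.1, h hx.2.2.2.2⟩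

theorem nbhd_sub (N : ℕ) (a : ℝ) (v : Vtx) (hv : v ∈ VN N) : nbhd N a v ⊆ VN N := by
  unfold nbhd
  split_ifs
  · exact fun _ h => h
  · intro x hx
    rw [Finset.mem_singleton] at hx
    rw [hx]; exact hv
  · exact Finset.filter_subset _ _

theorem nbhd_anti (N : ℕ) (hN : 1 ≤ N) (v : Vtx) (hv : v ∈ VN N) (a b : ℝ)
    (ha : 0 ≤ a) (hab : a ≤ b) (hb : b ≤ 1) : nbhd N b v ⊆ nbhd N a v := by
  have hN1 : (1:ℝ) ≤ N := by exact_mod_cast hN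
  by_cases ha0 : a = 0
  · intro x hx
    have := nbhd_sub N b v hv hx
    unfold nbhd
    rw [if_pos ha0]; exact this
  have hb0 : b ≠ 0 := fun h => ha0 (le_antisymm (h ▸ hab) ha)
  by_cases ha1 : a = 1
  · have hb1 : b = 1 := le_antisymm hb (ha1 ▸ hab)
    rw [ha1, hb1]
  intro x hx
  by_cases hb1 : b = 1
  · unfold nbhd at hx ⊢
    rw [if_neg hb0, if_pos hb1, Finset.mem_singleton] at hx
    rw [if_neg ha0, if_neg ha1, Finset.mem_filter, hx]
    have : 0 ≤ (N : ℝ) ^ ((1 : ℝ) - a) / 2 := by positivity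
    simpa using ⟨hv, this⟩
  · unfold nbhd at hx ⊢
    rw [if_neg hb0, if_neg hb1, Finset.mem_filter] at hx
    rw [if_neg ha0, if_neg ha1, Finset.mem_filter]
    have h := Real.rpow_le_rpow_of_exponent_le hN1 (by linarith : 1 - b ≤ 1 - a)
    exact ⟨hx.1, hx.2.1.trans (by linarith), hx.2.2.trans (by linarith)⟩

theorem scaleAlg_mono (N : ℕ) (hN : 1 ≤ N) (v : Vtx) (hv : v ∈ VN N) (a b : ℝ) (ha : 0 ≤ a)
    (hab : a ≤ b) (hb : b ≤ 1) : scaleAlg N a v ≤ scaleAlg N b v := by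
  refine algOn_mono (W := {w | w ∈ VN N ∧ w ∉ intr (nbhd N a v)})
    (W' := {w | w ∈ VN N ∧ w ∉ intr (nbhd N b v)}) ?_
  rintro w ⟨h1, h2⟩
  exact ⟨h1, fun h => h2 (intr_mono (nbhd_anti N hN v hv a b ha hab hb) h)⟩

theorem scaleAlg_le (N : ℕ) (a : ℝ) (v : Vtx) : scaleAlg N a v ≤ MeasurableSpace.pi :=
  algOn_le {w | w ∈ VN N ∧ w ∉ intr (nbhd N a v)}

theorem phi_tower (N : ℕ) (hN : 1 ≤ N) (P : Measure FieldSp) [IsProbabilityMeasure P]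
    (v : Vtx) (hv : v ∈ VN N) (a b : ℝ) (ha : 0 ≤ a) (ha1 : a ≤ 1) (hb : 0 ≤ b) (hb1 : b ≤ 1) :
    P[phiScale N P v a | scaleAlg N b v] =ᵐ[P] phiScale N P v (min a b) := by
  rcases le_total a b with h | h
  · have hs : StronglyMeasurable[scaleAlg N b v] (phiScale N P v a) :=
      stronglyMeasurable_condExp.mono (scaleAlg_mono N hN v hv a b ha h hb1)
    have hint : Integrable (phiScale N P v a) P := integrable_condExp
    rw [min_eq_left h, condExp_of_stronglyMeasurable (scaleAlg_le N b v) hs hint]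
  · rw [min_eq_right h]
    exact condExp_condExp_of_le (scaleAlg_mono N hN v hv b a hb h ha1) (scaleAlg_le N a v)

theorem psi_scale_eq (N M : ℕ) (hN : 1 ≤ N) (sigv lamv : ℕ → ℝ) (P : Measure FieldSp)
    [IsProbabilityMeasure P] (v : Vtx) (hv : v ∈ VN N)
    (hl : ∀ j, j ≤ M → 0 ≤ lamv j ∧ lamv j ≤ 1) (b : ℝ) (hb : 0 ≤ b) (hb1 : b ≤ 1) :
    psiScale N M sigv lamv P v b =ᵐ[P] fun ω => ∑ j ∈ Finset.Icc 1 M,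
      sigv j * (phiScale N P v (min (lamv j) b) ω - phiScale N P v (min (lamv (j - 1)) b) ω) := by
  have e : psiFld N M sigv lamv P v = ∑ j ∈ Finset.Icc 1 M,
      sigv j • (phiScale N P v (lamv j) - phiScale N P v (lamv (j - 1))) := by
    ext ω
    simp [psiFld, Finset.sum_apply]
  unfold psiScale
  rw [e]
  refine (condExp_finsetSum (fun j _ => (integrable_condExp.sub integrable_condExp).smul _) _).trans ?_
  have key : ∀ j ∈ Finset.Icc 1 M,
      P[sigv j • (phiScale N P v (lamv j) - phiScale N P v (lamv (j - 1))) | scaleAlg N b v] =ᵐ[P]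
      fun ω => sigv j * (phiScale N P v (min (lamv j) b) ω
        - phiScale N P v (min (lamv (j - 1)) b) ω) := by
    intro j hj
    rw [Finset.mem_Icc] at hj
    have t1 := phi_tower N hN P v hv (lamv j) b (hl j hj.2).1 (hl j hj.2).2 hb hb1
    have t2 := phi_tower N hN P v hv (lamv (j-1)) b (hl (j-1) (by omega)).1
      (hl (j-1) (by omega)).2 hb hb1
    have s1 := condExp_smul (μ := P) (sigv j)
      (phiScale N P v (lamv j) - phiScale N P v (lamv (j - 1))) (scaleAlg N b v)
    have s2 := condExp_sub (μ := P) (f := phiScale N P v (lamv j))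
      (g := phiScale N P v (lamv (j - 1))) integrable_condExp integrable_condExp (scaleAlg N b v)
    filter_upwards [t1, t2, s1, s2] with ω h1 h2 h3 h4
    rw [h3, Pi.smul_apply, h4, Pi.sub_apply, h1, h2, smul_eq_mul]
  have hall : ∀ᵐ ω ∂P, ∀ j ∈ Finset.Icc 1 M,
      (P[sigv j • (phiScale N P v (lamv j) - phiScale N P v (lamv (j - 1))) | scaleAlg N b v]) ω =
      sigv j * (phiScale N P v (min (lamv j) b) ω
        - phiScale N P v (min (lamv (j - 1)) b) ω) := by
    rw [Filter.eventually_all_finset]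
    exact key
  filter_upwards [hall] with ω h
  rw [Finset.sum_apply]
  exact Finset.sum_congr rfl h

theorem scale_mono {M : ℕ} {sigv lamv : ℕ → ℝ} (hp : ScaleParams M sigv lamv) (a b : ℕ)
    (hab : a ≤ b) (hb : b ≤ M) : lamv a ≤ lamv b := by
  induction b, hab using Nat.le_induction with
  | base => exact le_rfl
  | succ n hn ih => exact (ih (by omega)).trans (hp.2.2.2.2 n (by omega)).le

theorem scale_range {M : ℕ} {sigv lamv : ℕ → ℝ} (hp : ScaleParams M sigv lamv) (j : ℕ)
    (hj : j ≤ M) : 0 ≤ lamv j ∧ lamv j ≤ 1 := by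
  constructor
  · have := scale_mono hp 0 j (by omega) hj
    rwa [hp.2.2.1] at this
  · have := scale_mono hp j M hj le_rfl
    rwa [hp.2.2.2.1] at this

theorem psi_inc_eq (N M : ℕ) (hN : 1 ≤ N) (sigv lamv : ℕ → ℝ) (hp : ScaleParams M sigv lamv)
    (P : Measure FieldSp) [IsProbabilityMeasure P] (v : Vtx) (hv : v ∈ VN N)
    (i : ℕ) (hi : i ∈ Finset.Icc 1 M) (a b : ℝ) (ha : lamv (i - 1) ≤ a) (hab : a < b)
    (hb : b ≤ lamv i) :
    psiInc N M sigv lamv P v a b =ᵐ[P]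
      fun ω => sigv i * (phiScale N P v b ω - phiScale N P v a ω) := by
  have hi2 := Finset.mem_Icc.1 hi
  have r1 := scale_range hp i hi2.2
  have r0 := scale_range hp (i-1) (by omega)
  have h1 := psi_scale_eq N M hN sigv lamv P v hv (scale_range hp) a (by linarith) (by linarith)
  have h2 := psi_scale_eq N M hN sigv lamv P v hv (scale_range hp) b (by linarith) (by linarith)
  filter_upwards [h1, h2] with ω h1 h2
  unfold psiInc
  rw [h1, h2, ← Finset.sum_sub_distrib, Finset.sum_eq_single i]
  · rw [min_eq_right hb, min_eq_left (by linarith : lamv (i-1) ≤ b), min_eq_left ha,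
      min_eq_right (by linarith : a ≤ lamv i)]
    ring
  · intro j hj hji
    rw [Finset.mem_Icc] at hj
    rcases lt_or_gt_of_ne hji with h | h
    · have q1 := scale_mono hp j (i-1) (by omega) (by omega)
      have q2 := scale_mono hp (j-1) (i-1) (by omega) (by omega)
      rw [min_eq_left (by linarith : lamv j ≤ b), min_eq_left (by linarith : lamv j ≤ a),
        min_eq_left (by linarith : lamv (j-1) ≤ b), min_eq_left (by linarith : lamv (j-1) ≤ a)]
      ring
    · have q1 := scale_mono hp i j (by omega) (by omega)
      have q2 := scale_mono hp i (j-1) (by omega) (by omega)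
      rw [min_eq_right (by linarith : b ≤ lamv j), min_eq_right (by linarith : a ≤ lamv j),
        min_eq_right (by linarith : b ≤ lamv (j-1)), min_eq_right (by linarith : a ≤ lamv (j-1))]
      ring
  · intro h; exact absurd hi h

/-- Local Green function at scale `a` around `v`. -/
def LocG (N : ℕ) (a : ℝ) (v : Vtx) (g : Vtx → ℝ) : Prop :=
  (∀ x ∉ intr (nbhd N a v), g x = 0) ∧
  ∀ x ∈ intr (nbhd N a v), lapA g x = Real.pi / 2 * (if x = v then 1 else 0)

theorem phi_inc_sq (N : ℕ) (hN : 1 ≤ N) (P : Measure FieldSp) (G : Vtx → Vtx → ℝ)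
    (h : GLaw (VN N) G P) (v : Vtx) (hv : v ∈ VN N) (a b : ℝ) (ha0 : 0 ≤ a) (hab : a ≤ b)
    (hb1 : b ≤ 1) (ga gb : Vtx → ℝ) (ha : LocG N a v ga) (hb : LocG N b v gb) :
    ∫ ω, (phiScale N P v b ω - phiScale N P v a ω) ^ 2 ∂P = ga v - gb v := by
  have hsub := intr_mono (nbhd_anti N hN v hv a b ha0 hab hb1)
  have e1 := h.condExp_eq (intr (nbhd N a v)) (intr_mono (nbhd_sub N a v hv)) v hv ga ha.1 ha.2
  have e2 := h.condExp_eq (intr (nbhd N b v)) (intr_mono (nbhd_sub N b v hv)) v hv gb hb.1 hb.2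
  have e3 : ∀ᵐ ω ∂P, (phiScale N P v b ω - phiScale N P v a ω) ^ 2 =
      XF (VN N) ((fun x => 2/Real.pi * lapA ga x) - (fun x => 2/Real.pi * lapA gb x)) ω ^ 2 := by
    filter_upwards [e1, e2] with ω e1 e2
    have e1' : phiScale N P v a ω = _ := e1
    have e2' : phiScale N P v b ω = _ := e2
    rw [e1', e2', XF_sub]
    ring
  rw [integral_congr_ae e3, h.sq, BF_expand_sub h.green]
  have ia : ∀ x ∉ intr (VN N), ga x = 0 := fun x hx =>
    ha.1 x (fun hh => hx (intr_mono (nbhd_sub N a v hv) hh))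
  have ib : ∀ x ∉ intr (VN N), gb x = 0 := fun x hx =>
    hb.1 x (fun hh => hx (intr_mono (nbhd_sub N b v hv) hh))
  rw [BF_green h.green ga _ ia, BF_green h.green gb _ ib, BF_green h.green gb _ ib]
  have hpi := Real.pi_ne_zero
  have gen : ∀ (g k : Vtx → ℝ), (∀ x, g x ≠ 0 → lapA k x = Real.pi / 2 * (if x = v then 1 else 0)) →
      ∑ x ∈ VN N, g x * (2/Real.pi * lapA k x) = g v := by
    intro g k hgk
    rw [Finset.sum_eq_single v]
    · by_cases h0 : g v = 0
      · rw [h0, zero_mul]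
      · rw [hgk v h0, if_pos rfl]; field_simp
    · intro x _ hx
      by_cases h0 : g x = 0
      · rw [h0, zero_mul]
      · rw [hgk x h0, if_neg hx]; ring
    · intro h; exact absurd hv h
  rw [gen ga ga (fun x hx => ha.2 x (by by_contra hh; exact hx (ha.1 x hh))),
    gen gb ga (fun x hx => ha.2 x (hsub (by by_contra hh; exact hx (hb.1 x hh)))),
    gen gb gb (fun x hx => hb.2 x (by by_contra hh; exact hx (hb.1 x hh)))]
  ring

theorem locG_one (N : ℕ) (v : Vtx) : LocG N 1 v (fun _ => 0) := by
  refine ⟨fun _ _ => rfl, fun x hx => ?_⟩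
  exfalso
  rw [mem_intr_iff] at hx
  have e : nbhd N 1 v = {v} := by
    unfold nbhd
    rw [if_neg one_ne_zero, if_pos rfl]
  rw [e] at hx
  simp only [Finset.mem_singleton] at hx
  have h1 := congrArg Prod.fst hx.1
  have h2 := congrArg Prod.fst hx.2.1
  simp only at h1 h2
  omega

theorem nbhd_box (N : ℕ) (hN : 1 ≤ N) (v : Vtx) (ρ a : ℝ) (hρ : ρ ≤ a) (ha0 : 0 < a) (ha1 : a < 1)
    (hv : v ∈ AN N ρ) (x : Vtx) : x ∈ nbhd N a v ↔
      (-((⌊(N:ℝ) ^ (1 - a) / 2⌋₊ : ℕ) : ℤ) ≤ x.1 - v.1 ∧ x.1 - v.1 ≤ (⌊(N:ℝ) ^ (1 - a) / 2⌋₊ : ℕ)) ∧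
      (-((⌊(N:ℝ) ^ (1 - a) / 2⌋₊ : ℕ) : ℤ) ≤ x.2 - v.2 ∧ x.2 - v.2 ≤ (⌊(N:ℝ) ^ (1 - a) / 2⌋₊ : ℕ)) := by
  have hN1 : (1:ℝ) ≤ N := by exact_mod_cast hN
  set L := (N:ℝ) ^ (1 - a) with hL
  have hL1 : 0 < L := Real.rpow_pos_of_pos (by linarith) _
  have hLρ : L ≤ (N:ℝ) ^ (1 - ρ) := Real.rpow_le_rpow_of_exponent_le hN1 (by linarith)
  have fl : ∀ z : ℤ, |(z:ℝ)| ≤ L / 2 ↔ -((⌊L/2⌋₊ : ℕ) : ℤ) ≤ z ∧ z ≤ (⌊L/2⌋₊ : ℕ) := by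
    intro z
    rw [← abs_le, ← Int.cast_abs, ← Int.natCast_natAbs, Int.cast_natCast, ← Nat.le_floor_iff (by positivity)]
    omega
  unfold AN at hv
  rw [Finset.mem_filter] at hv
  obtain ⟨hvV, hvd⟩ := hv
  have hmem : ∀ y : Vtx, y ∈ VN N ↔ (0 ≤ y.1 ∧ 0 ≤ y.2) ∧ y.1 ≤ N ∧ y.2 ≤ N := by
    intro y
    unfold VN
    rw [Finset.mem_Icc, Prod.le_def, Prod.le_def]
  unfold nbhd
  rw [if_neg ha0.ne', if_neg ha1.ne, Finset.mem_filter, ← hL]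
  have c1 : (x.1:ℝ) - v.1 = ((x.1 - v.1 : ℤ) : ℝ) := by push_cast; ring
  have c2 : (x.2:ℝ) - v.2 = ((x.2 - v.2 : ℤ) : ℝ) := by push_cast; ring
  rw [← fl, ← fl, c1, c2]
  constructor
  · exact fun h => h.2
  · intro h
    refine ⟨?_, h⟩
    by_contra hx
    have hd := hvd x hx
    have q : Real.sqrt (((v.1 : ℝ) - (x.1 : ℝ)) ^ 2 + ((v.2 : ℝ) - (x.2 : ℝ)) ^ 2) < L := by
      rw [Real.sqrt_lt' hL1]
      rw [← c1, ← c2, abs_le, abs_le] at h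
      obtain ⟨⟨h1, h2⟩, h3, h4⟩ := h
      nlinarith [mul_pos hL1 hL1, mul_nonneg (sub_nonneg.2 h1) (sub_nonneg.2 h2),
        mul_nonneg (sub_nonneg.2 h3) (sub_nonneg.2 h4)]
    linarith

theorem locG_box (N : ℕ) (hN : 1 ≤ N) (v : Vtx) (ρ a : ℝ) (hρ : ρ ≤ a) (ha0 : 0 < a) (ha1 : a < 1)
    (hv : v ∈ AN N ρ) (hm : 1 ≤ ⌊(N:ℝ) ^ (1 - a) / 2⌋₊) :
    LocG N a v (fun x => gBox ⌊(N:ℝ) ^ (1 - a) / 2⌋₊ (x.1 - v.1, x.2 - v.2)) := by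
  have hb := nbhd_box N hN v ρ a hρ ha0 ha1 hv
  set m := ⌊(N:ℝ) ^ (1 - a) / 2⌋₊ with hmdef
  have hi : ∀ x, x ∈ intr (nbhd N a v) ↔ (-(m:ℤ) < x.1 - v.1 ∧ x.1 - v.1 < m) ∧
      (-(m:ℤ) < x.2 - v.2 ∧ x.2 - v.2 < m) := by
    intro x
    rw [mem_intr_iff, hb, hb, hb, hb, hb]
    simp only
    omega
  refine ⟨fun x hx => ?_, fun x hx => ?_⟩
  · rw [hi] at hx
    exact gBox_zero m _ hx
  · rw [hi] at hx
    have hp := gBox_poisson m hm (x.1 - v.1, x.2 - v.2) hx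
    unfold lapA
    simp only at hp ⊢
    have e : ((x.1 - v.1, x.2 - v.2) : ℤ × ℤ) = 0 ↔ x = v := by
      rw [Prod.ext_iff, Prod.ext_iff]
      simp [sub_eq_zero]
    simp only [e] at hp
    rw [hp]
    rw [show x.1 + 1 - v.1 = x.1 - v.1 + 1 by ring, show x.1 - 1 - v.1 = x.1 - v.1 - 1 by ring,
      show x.2 + 1 - v.2 = x.2 - v.2 + 1 by ring, show x.2 - 1 - v.2 = x.2 - v.2 - 1 by ring]
    ring

theorem locG_log (N : ℕ) (hN : 1 ≤ N) (v : Vtx) (ρ a : ℝ) (hρ : ρ ≤ a) (ha0 : 0 < a) (ha1 : a < 1)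
    (hv : v ∈ AN N ρ) (hL : 4 ≤ (N:ℝ) ^ (1 - a)) :
    ∃ g, LocG N a v g ∧ |g v - (1 - a) * Real.log N| ≤ 43 := by
  have hN1 : (1:ℝ) ≤ N := by exact_mod_cast hN
  have hf1 : ((⌊(N:ℝ) ^ (1 - a) / 2⌋₊ : ℕ) : ℝ) ≤ (N:ℝ) ^ (1 - a) / 2 := Nat.floor_le (by linarith)
  have hf2 := Nat.lt_floor_add_one ((N:ℝ) ^ (1 - a) / 2)
  have hm : 1 ≤ ⌊(N:ℝ) ^ (1 - a) / 2⌋₊ := by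
    rw [Nat.one_le_floor_iff]; linarith
  refine ⟨_, locG_box N hN v ρ a hρ ha0 ha1 hv hm, ?_⟩
  have hg := gBox_log _ hm
  have hlog : Real.log ((N:ℝ) ^ (1 - a)) = (1 - a) * Real.log N := Real.log_rpow (by linarith) _
  set m := ⌊(N:ℝ) ^ (1 - a) / 2⌋₊
  set L := (N:ℝ) ^ (1 - a)
  have hm0 : (0:ℝ) < m := by exact_mod_cast hm
  have l1 : Real.log m ≤ Real.log L := Real.log_le_log hm0 (by linarith)
  have l2 : Real.log L ≤ Real.log (4 * m) := Real.log_le_log (by linarith) (by linarith)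
  rw [Real.log_mul (by norm_num) hm0.ne'] at l2
  have l4 : Real.log 4 ≤ 4 - 1 := Real.log_le_sub_one_of_pos (by norm_num)
  simp only [sub_self]
  have hz : ((0, 0) : ℤ × ℤ) = 0 := rfl
  rw [hz, ← hlog]
  rw [abs_le] at hg ⊢
  constructor <;> linarith [hg.1, hg.2]

theorem locG_any (N : ℕ) (hN : 1 ≤ N) (v : Vtx) (ρ a : ℝ) (hρ : ρ ≤ a) (ha0 : 0 < a) (ha1 : a ≤ 1)
    (hv : v ∈ AN N ρ) (hL : a < 1 → 4 ≤ (N:ℝ) ^ (1 - a)) :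
    ∃ g, LocG N a v g ∧ |g v - (1 - a) * Real.log N| ≤ 43 := by
  rcases ha1.lt_or_eq with h | h
  · exact locG_log N hN v ρ a hρ ha0 h hv (hL h)
  · subst h
    refine ⟨_, locG_one N v, ?_⟩
    norm_num

theorem large_pow (a : ℝ) : ∃ N₀ : ℕ, ∀ N : ℕ, N₀ ≤ N → a < 1 → 4 ≤ (N:ℝ) ^ (1 - a) := by
  by_cases h : a < 1
  · have := (tendsto_rpow_atTop (by linarith : 0 < 1 - a)).comp (tendsto_natCast_atTop_atTop (R := ℝ))
    obtain ⟨N₀, hN₀⟩ := Filter.eventually_atTop.1 (this.eventually_ge_atTop 4)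
    exact ⟨N₀, fun N hN _ => hN₀ N hN⟩
  · exact ⟨0, fun _ _ h' => absurd h' h⟩

end FinalPart

/-- **Lemma (Variance of the increments away from the boundary).**
Let `λ_{i−1} ≤ α < α' ≤ λ_i` with `α ≠ 0` and `ρ ∈ (0,α]`. Then there is `C > 0` such
that for all `N` large enough (dependent on `α` but independent of `ρ`),
`max_{v∈A_{N,ρ}} |E[ψ_v(α,α')²] − (α'−α)σ_i² log N| ≤ C σ_i²`. -/
theorem variance_of_increments
    (M : ℕ) (sigv lamv : ℕ → ℝ) (hparams : ScaleParams M sigv lamv)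
    (P : ℕ → MeasureTheory.Measure FieldSp) (hGFF : ∀ N, IsGFF N (P N))
    (i : ℕ) (hi : i ∈ Finset.Icc 1 M)
    (α α' : ℝ) (hα : lamv (i - 1) ≤ α) (hα0 : α ≠ 0) (hαα' : α < α') (hα' : α' ≤ lamv i) :
    ∃ C : ℝ, 0 < C ∧ ∃ N₀ : ℕ, ∀ ρ : ℝ, 0 < ρ → ρ ≤ α → ∀ N ≥ N₀, ∀ v ∈ AN N ρ,
      |(∫ ω, (psiInc N M sigv lamv (P N) v α α' ω) ^ 2 ∂(P N)) -
          (α' - α) * (sigv i) ^ 2 * Real.log N|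
        ≤ C * (sigv i) ^ 2 := by
  have hi2 := Finset.mem_Icc.1 hi
  have r1 := scale_range hparams i hi2.2
  have r0 := scale_range hparams (i-1) (by omega)
  have hα00 : 0 < α := lt_of_le_of_ne (by linarith) (Ne.symm hα0)
  obtain ⟨N₁, hN₁⟩ := large_pow α
  obtain ⟨N₂, hN₂⟩ := large_pow α'
  refine ⟨86, by norm_num, N₁ + N₂ + 1, ?_⟩
  intro ρ _ hρα N hN v hv
  have hN1 : 1 ≤ N := by omega
  obtain ⟨hP, G, hG, hlaw⟩ := hGFF N
  have hGL : GLaw (VN N) G (P N) := ⟨hP, hG, hlaw⟩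
  have hvV : v ∈ VN N := (Finset.mem_filter.1 hv).1
  obtain ⟨g, hg, hgl⟩ := locG_any N hN1 v ρ α hρα hα00 (by linarith) hv (hN₁ N (by omega))
  obtain ⟨k, hk, hkl⟩ := locG_any N hN1 v ρ α' (by linarith) (by linarith) (by linarith) hv
    (hN₂ N (by omega))
  have e := psi_inc_eq N M hN1 sigv lamv hparams (P N) v hvV i hi α α' hα hαα' hα'
  have e2 : ∫ ω, (psiInc N M sigv lamv (P N) v α α' ω) ^ 2 ∂(P N) = sigv i ^ 2 * (g v - k v) := by
    rw [← phi_inc_sq N hN1 (P N) G hGL v hvV α α' hα00.le hαα'.le (by linarith) g k hg hk,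
      ← MeasureTheory.integral_const_mul]
    refine MeasureTheory.integral_congr_ae ?_
    filter_upwards [e] with ω h
    rw [h]; ring
  rw [e2]
  have e3 : sigv i ^ 2 * (g v - k v) - (α' - α) * sigv i ^ 2 * Real.log N =
      ((g v - (1 - α) * Real.log N) - (k v - (1 - α') * Real.log N)) * sigv i ^ 2 := by ring
  rw [e3, abs_mul, abs_of_nonneg (sq_nonneg (sigv i))]
  refine mul_le_mul_of_nonneg_right ?_ (sq_nonneg _)
  rw [abs_le] at hgl hkl ⊢
  constructor <;> linarith [hgl.1, hgl.2, hkl.1, hkl.2]
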